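/- In the minimal generating set of C_{4,2} consisting of the traces of the 32 words x, y, x², xy, y², x³, x²y, xy², y³, x⁴, x³y, x²y², xy³, y⁴, xyxy, (x²y)², (y²x)², x³y², y³x², x²y²xy, y²x²yx, x³y²xy, y³x²yx, x³y²x²y, y³x²y²x, x³y³xy, y³x³yx, x³yx²yxy, x²y²xyx²y, y²x²yxy²x, y³xy²xyx, x³y³x²y², the words y³x²yx, y³x²y²x, y²x²yxy²x, y³xy²xyx can be replaced with xyx²y³, xy²x²y³, xy²xyx²y², xyxy²xy³, respectively, and the resulting 32 traces still form a minimal generating set of the K-algebra C_{4,2}. -/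

import Mathlib

open MvPolynomial Matrix

noncomputable section

/-- Index type for the entries of a pair of generic `n × n` matrices:
`Sum.inl (i,j)` indexes the `(i,j)` entry of `x`, `Sum.inr (i,j)` that of `y`. -/
abbrev MatVar (n : ℕ) := (Fin n × Fin n) ⊕ (Fin n × Fin n)

/-- The substitution sending the variables to the entries of the pair `(A, B)`. -/
def pairSub {K : Type*} [CommSemiring K] {n : ℕ} (A B : Matrix (Fin n) (Fin n) K) :
    MatVar n → K
  | Sum.inl ij => A ij.1 ij.2
  | Sum.inr ij => B ij.1 ij.2

/-- A polynomial function on pairs of `n × n` matrices is `GLₙ`-invariant (for the action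
by simultaneous conjugation). -/
def IsMatInvariant {K : Type*} [Field K] {n : ℕ} (f : MvPolynomial (MatVar n) K) : Prop :=
  ∀ (a : GL (Fin n) K) (A B : Matrix (Fin n) (Fin n) K),
    MvPolynomial.eval
        (pairSub ((a : Matrix (Fin n) (Fin n) K) * A * ((a⁻¹ : GL (Fin n) K) : Matrix (Fin n) (Fin n) K))
          ((a : Matrix (Fin n) (Fin n) K) * B * ((a⁻¹ : GL (Fin n) K) : Matrix (Fin n) (Fin n) K))) f =
      MvPolynomial.eval (pairSub A B) f

/-- The weight giving the bidegree: entries of `x` have weight `(1,0)`,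
those of `y` have weight `(0,1)`. -/
def bideg (n : ℕ) : MatVar n → ℕ × ℕ
  | Sum.inl _ => (1, 0)
  | Sum.inr _ => (0, 1)

/-- The bigraded component of bidegree `(p, q)` of the pure trace algebra `C_{n,2}`. -/
def pureComponent (K : Type*) [Field K] (n p q : ℕ) : Set (MvPolynomial (MatVar n) K) :=
  {f | IsMatInvariant f ∧ f.IsWeightedHomogeneous (bideg n) (p, q)}

/-- `dim_K C_{n,2}^{(p,q)}`. -/
def pureDim (K : Type*) [Field K] (n p q : ℕ) : ℕ :=
  Set.finrank K (pureComponent K n p q)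

/-- The bigraded Poincaré series `P(C_{n,2}; s, t)`, with `s` the variable `X 0` and
`t` the variable `X 1`. -/
def purePS2 (K : Type*) [Field K] (n : ℕ) : MvPowerSeries (Fin 2) ℚ :=
  fun d => (pureDim K n (d 0) (d 1) : ℚ)

/-- abbreviation for the power series variable `s`. -/
def ps : MvPowerSeries (Fin 2) ℚ := MvPowerSeries.X 0

/-- abbreviation for the power series variable `t`. -/
def pt : MvPowerSeries (Fin 2) ℚ := MvPowerSeries.X 1


/-- The pure trace algebra `C_{n,2}`: the subalgebra of `GLₙ`-invariant polynomial
functions on pairs of `n × n` matrices. -/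
def pureAlg (K : Type*) [Field K] (n : ℕ) : Subalgebra K (MvPolynomial (MatVar n) K) where
  carrier := {f | IsMatInvariant f}
  mul_mem' := fun hf hg a A B => by
    simp only [_root_.map_mul]
    rw [hf a A B, hg a A B]
  add_mem' := fun hf hg a A B => by
    simp only [_root_.map_add]
    rw [hf a A B, hg a A B]
  algebraMap_mem' := fun c a A B => by
    simp [MvPolynomial.algebraMap_eq]

/-- The generic matrix `x`, whose entries are the corresponding polynomial variables. -/
def genX (K : Type*) [Field K] (n : ℕ) :
    Matrix (Fin n) (Fin n) (MvPolynomial (MatVar n) K) :=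
  Matrix.of fun i j => MvPolynomial.X (Sum.inl (i, j))

/-- The generic matrix `y`, whose entries are the corresponding polynomial variables. -/
def genY (K : Type*) [Field K] (n : ℕ) :
    Matrix (Fin n) (Fin n) (MvPolynomial (MatVar n) K) :=
  Matrix.of fun i j => MvPolynomial.X (Sum.inr (i, j))

/-- The traces of the 32 words
`x, y, x², xy, y², x³, x²y, xy², y³, x⁴, x³y, x²y², xy³, y⁴, xyxy, (x²y)², (y²x)²,
x³y², y³x², x²y²xy, y²x²yx, x³y²xy, xyx²y³, x³y²x²y, xy²x²y³, x³y³xy, y³x³yx,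
x³yx²yxy, x²y²xyx²y, xy²xyx²y², xyxy²xy³, x³y³x²y²`
(obtained from the 32 words of Theorem `Gen-1` by replacing `y³x²yx, y³x²y²x, y²x²yxy²x,
y³xy²xyx` with `xyx²y³, xy²x²y³, xy²xyx²y², xyxy²xy³`) in the generic `4 × 4` matrices. -/
def gens32' (K : Type*) [Field K] : Fin 32 → MvPolynomial (MatVar 4) K :=
  let x := genX K 4
  let y := genY K 4
  ![(x).trace, (y).trace,
    (x ^ 2).trace, (x * y).trace, (y ^ 2).trace,
    (x ^ 3).trace, (x ^ 2 * y).trace, (x * y ^ 2).trace, (y ^ 3).trace,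
    (x ^ 4).trace, (x ^ 3 * y).trace, (x ^ 2 * y ^ 2).trace, (x * y ^ 3).trace,
    (y ^ 4).trace, (x * y * x * y).trace, ((x ^ 2 * y) ^ 2).trace, ((y ^ 2 * x) ^ 2).trace,
    (x ^ 3 * y ^ 2).trace, (y ^ 3 * x ^ 2).trace,
    (x ^ 2 * y ^ 2 * x * y).trace, (y ^ 2 * x ^ 2 * y * x).trace,
    (x ^ 3 * y ^ 2 * x * y).trace, (x * y * x ^ 2 * y ^ 3).trace,
    (x ^ 3 * y ^ 2 * x ^ 2 * y).trace, (x * y ^ 2 * x ^ 2 * y ^ 3).trace,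
    (x ^ 3 * y ^ 3 * x * y).trace, (y ^ 3 * x ^ 3 * y * x).trace,
    (x ^ 3 * y * x ^ 2 * y * x * y).trace, (x ^ 2 * y ^ 2 * x * y * x ^ 2 * y).trace,
    (x * y ^ 2 * x * y * x ^ 2 * y ^ 2).trace, (x * y * x * y ^ 2 * x * y ^ 3).trace,
    (x ^ 3 * y ^ 3 * x ^ 2 * y ^ 2).trace]

section
noncomputable section
section PtrTheory
open Equiv

/-- generalized trace attached to a permutation -/
def ptr {α : Type*} [Fintype α] [DecidableEq α] {A : Type*} [CommRing A] (σ : Perm α)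
    (z : α → Matrix (Fin 4) (Fin 4) A) : A :=
  ∑ J : α → Fin 4, ∏ k, z (σ k) (J k) (J (σ k))

theorem ptr_eq {α : Type*} [Fintype α] [DecidableEq α] {A : Type*} [CommRing A] (σ : Perm α)
    (z : α → Matrix (Fin 4) (Fin 4) A) :
    ptr σ z = ∑ I : α → Fin 4, ∏ k, z k (I k) (I (σ k)) := by
  unfold ptr
  refine Fintype.sum_equiv (Equiv.arrowCongr σ (Equiv.refl _)) _ _ fun J => ?_
  refine Fintype.prod_equiv σ _ _ fun k => ?_
  simp [Equiv.arrowCongr]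

theorem ptr_conj {α β : Type*} [Fintype α] [DecidableEq α] [Fintype β] [DecidableEq β]
    {A : Type*} [CommRing A] (e : α ≃ β) (σ : Perm α) (z : β → Matrix (Fin 4) (Fin 4) A) :
    ptr (e.permCongr σ) z = ptr σ (z ∘ e) := by
  unfold ptr
  refine Fintype.sum_equiv (Equiv.arrowCongr e.symm (Equiv.refl _)) _ _ fun J => ?_
  refine Fintype.prod_equiv e.symm _ _ fun k => ?_
  simp [Equiv.arrowCongr, Equiv.permCongr_apply]

theorem ptr_none {α : Type*} [Fintype α] [DecidableEq α] {A : Type*} [CommRing A] (e : Perm α)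
    (z : Option α → Matrix (Fin 4) (Fin 4) A) :
    ptr (swap none none * optionCongr e) z = (z none).trace * ptr e (z ∘ some) := by
  unfold ptr
  rw [← (Equiv.piOptionEquivProd (β := fun _ => Fin 4)).symm.sum_comp, Fintype.sum_prod_type,
    Matrix.trace, Finset.sum_mul_sum]
  refine Finset.sum_congr rfl fun i _ => Finset.sum_congr rfl fun J _ => ?_
  rw [Fintype.prod_option]
  simp [Equiv.piOptionEquivProd, Perm.one_apply]

theorem ptr_some {α : Type*} [Fintype α] [DecidableEq α] {A : Type*} [CommRing A] (e : Perm α)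
    (q : α) (z : Option α → Matrix (Fin 4) (Fin 4) A) :
    ptr (swap none (some q) * optionCongr e) z =
      ptr e (Function.update (z ∘ some) q (z none * z (some q))) := by
  unfold ptr
  rw [← (Equiv.piOptionEquivProd (β := fun _ => Fin 4)).symm.sum_comp, Fintype.sum_prod_type,
    Finset.sum_comm]
  refine Finset.sum_congr rfl fun J _ => ?_
  have hk : e (e.symm q) = q := by simp
  rw [← Finset.mul_prod_erase Finset.univ _ (Finset.mem_univ (e.symm q))]
  simp only [hk, Function.update_self, Matrix.mul_apply, Finset.sum_mul]
  refine Finset.sum_congr rfl fun i _ => ?_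
  rw [Fintype.prod_option, ← Finset.mul_prod_erase Finset.univ _ (Finset.mem_univ (e.symm q))]
  have h1 : (swap none (some q) * optionCongr e : Perm (Option α)) none = some q := by simp
  have h2 : (swap none (some q) * optionCongr e : Perm (Option α)) (some (e.symm q)) = none := by
    simp
  rw [h1, h2]
  have h3 : ∀ k ∈ Finset.univ.erase (e.symm q),
      (swap none (some q) * optionCongr e : Perm (Option α)) (some k) = some (e k) := by
    intro k hk
    have : e k ≠ q := fun h => (Finset.ne_of_mem_erase hk) (by rw [← h]; simp)
    simp only [Perm.mul_apply, optionCongr_apply, Option.map_some]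
    exact swap_apply_of_ne_of_ne (by simp) (by simpa using this)
  rw [← mul_assoc]
  congr 1
  · simp [Equiv.piOptionEquivProd, mul_comm]
  · refine Finset.prod_congr rfl fun k hk => ?_
    have h4 : e k ≠ q := fun h => (Finset.ne_of_mem_erase hk) (by rw [← h]; simp)
    rw [h3 k hk]
    simp [Equiv.piOptionEquivProd, Function.update_of_ne h4]

theorem perm_option_cases {α : Type*} [DecidableEq α] (σ : Perm (Option α)) :
    ∃ p e, σ = swap none p * optionCongr e := by
  refine ⟨(Perm.decomposeOption σ).1, (Perm.decomposeOption σ).2, ?_⟩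
  rw [← Perm.decomposeOption_symm_apply]; simp

/-- fundamental trace identity -/
theorem fundamental {α : Type*} [Fintype α] [DecidableEq α] (hα : Fintype.card α = 5)
    {A : Type*} [CommRing A] (z : α → Matrix (Fin 4) (Fin 4) A) :
    ∑ σ : Perm α, (((Perm.sign σ : ℤˣ) : ℤ) : A) * ptr σ z = 0 := by
  simp only [ptr_eq, Finset.mul_sum]
  rw [Finset.sum_comm]
  refine Finset.sum_eq_zero fun I _ => ?_
  obtain ⟨a, b, hab, hI⟩ := Fintype.exists_ne_map_eq_of_card_lt I (by simp [hα])
  have h2 : (Matrix.of fun l k => z k (I k) (I l)).det = 0 :=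
    Matrix.det_zero_of_row_eq hab (by ext k; simp [hI])
  rw [Matrix.det_apply'] at h2
  simpa using h2

/-- evaluation of words at generic matrices -/
def mat (K : Type*) [Field K] (w : List Bool) : Matrix (Fin 4) (Fin 4) (MvPolynomial (MatVar 4) K) :=
  (w.map fun b => if b then genY K 4 else genX K 4).prod

def trw (K : Type*) [Field K] (w : List Bool) : MvPolynomial (MatVar 4) K := (mat K w).trace

theorem mat_append (K : Type*) [Field K] (u v : List Bool) : mat K (u ++ v) = mat K u * mat K v := by
  simp [mat]

theorem trw_cyc (K : Type*) [Field K] (u v : List Bool) : trw K (u ++ v) = trw K (v ++ u) := by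
  simp only [trw, mat_append]; exact Matrix.trace_mul_comm _ _

theorem mat_update {α : Type*} [DecidableEq α] (K : Type*) [Field K] (z : Option α → List Bool) (q : α) :
    Function.update ((fun k => mat K (z k)) ∘ some) q (mat K (z none) * mat K (z (some q))) =
      fun k => mat K (Function.update (z ∘ some) q (z none ++ z (some q)) k) := by
  funext k
  by_cases h : k = q
  · subst h; simp [mat_append]
  · simp [h]

theorem sum_len_update {α : Type*} [DecidableEq α] [Fintype α] (z : Option α → List Bool) (q : α) :
    ∑ k, (Function.update (z ∘ some) q (z none ++ z (some q)) k).length = ∑ k, (z k).length := by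
  rw [Fintype.sum_option, ← Finset.add_sum_erase Finset.univ _ (Finset.mem_univ q),
    ← Finset.add_sum_erase (a := q) Finset.univ (fun k => (z (some k)).length) (Finset.mem_univ q)]
  rw [Finset.sum_congr rfl (g := fun k => (z (some k)).length)]
  · simp; omega
  · intro k hk
    simp [Finset.ne_of_mem_erase hk]

theorem ptr_mem (K : Type*) [Field K] (S : Subalgebra K (MvPolynomial (MatVar 4) K)) (N : ℕ)
    (h : ∀ w : List Bool, w.length ≤ N → trw K w ∈ S) (α : Type) [Fintype α] :
    ∀ [DecidableEq α] (σ : Perm α) (z : α → List Bool), ∑ k, (z k).length ≤ N →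
      ptr σ (fun k => mat K (z k)) ∈ S := by
  refine Fintype.induction_empty_option (P := fun α _ => ∀ [DecidableEq α] (σ : Perm α)
    (z : α → List Bool), ∑ k, (z k).length ≤ N → ptr σ (fun k => mat K (z k)) ∈ S) ?_ ?_ ?_ α
  · intro α β _ e ih _ σ z hz
    classical
    letI := Fintype.ofEquiv β e.symm
    obtain ⟨σ, rfl⟩ := e.permCongr.surjective σ
    rw [ptr_conj]
    refine ih σ (z ∘ e) ?_
    rw [← e.sum_comp] at hz
    simpa using hz
  · intro _ σ z _
    simp only [ptr, Finset.univ_eq_empty, Finset.prod_empty]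
    exact S.sum_mem fun _ _ => S.one_mem
  · intro α _ ih inst σ z hz
    classical
    obtain rfl : inst = Option.instDecidableEq := Subsingleton.elim _ _
    obtain ⟨p, e, rfl⟩ := perm_option_cases σ
    rcases p with _ | q
    · rw [ptr_none]
      rw [Fintype.sum_option] at hz
      exact S.mul_mem (h _ (by omega)) (ih e (z ∘ some) (by simp only [Function.comp_apply]; omega))
    · rw [ptr_some, mat_update]
      exact ih e _ (by rw [sum_len_update]; exact hz)

end PtrTheory
end
end

section
noncomputable section
section Tensor
open Equiv

def expo {V : Type*} {m : ℕ} (t : Fin m → V) : V →₀ ℕ := ∑ k, Finsupp.single (t k) 1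

theorem prod_X_eq {V K : Type*} [Field K] {m : ℕ} (t : Fin m → V) :
    (∏ k, (X (t k) : MvPolynomial V K)) = monomial (expo t) 1 := by
  simp only [expo, X, MvPolynomial.monomial_sum_one]

theorem expo_apply {V : Type*} [DecidableEq V] {m : ℕ} (t : Fin m → V) (v : V) :
    expo t v = Fintype.card {k // t k = v} := by
  rw [Fintype.card_subtype, Finset.card_filter, expo, Finsupp.finsetSum_apply]
  refine Finset.sum_congr rfl fun k _ => ?_
  rw [Finsupp.single_apply]

theorem expo_eq_perm {V : Type*} {m : ℕ} (t s : Fin m → V) (h : expo t = expo s) :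
    ∃ π : Perm (Fin m), s ∘ π = t := by
  classical
  have : ∀ v, Nonempty ({k // t k = v} ≃ {k // s k = v}) := fun v => by
    rw [← Fintype.card_eq]
    have h1 := expo_apply t v
    have h2 := expo_apply s v
    rw [h, h2] at h1
    convert h1.symm
  have e := fun v => Classical.choice (this v)
  exact ⟨Equiv.ofFiberEquiv e, funext fun k => Equiv.ofFiberEquiv_map e k⟩

open Classical in
theorem exists_phi {V K : Type*} [Field K] {m : ℕ} (E : (Fin m → V) → K)
    (hE : ∀ t (π : Perm (Fin m)), E (t ∘ π) = E t) :
    ∃ Φ : MvPolynomial V K →ₗ[K] K, ∀ t : Fin m → V, Φ (∏ k, X (t k)) = E t := by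
  refine ⟨(MvPolynomial.basisMonomials V K).constr K
    fun s => if h : ∃ t : Fin m → V, expo t = s then E h.choose else 0, fun t => ?_⟩
  have h1 : (∏ k, (X (t k) : MvPolynomial V K)) = MvPolynomial.basisMonomials V K (expo t) := by
    rw [prod_X_eq]; simp
  rw [h1, Module.Basis.constr_basis]
  have h : ∃ t' : Fin m → V, expo t' = expo t := ⟨t, rfl⟩
  rw [dif_pos h]
  obtain ⟨π, hπ⟩ := expo_eq_perm _ _ h.choose_spec
  rw [← hπ, hE]

/-- homogeneous polynomials are symmetric tensors -/
theorem exists_tensor {V K : Type*} [Fintype V] [Field K] [CharZero K] {m : ℕ} (f : MvPolynomial V K)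
    (hf : f.IsHomogeneous m) : ∃ T : (Fin m → V) → K, (∀ t (π : Perm (Fin m)), T (t ∘ π) = T t) ∧
      f = ∑ t, C (T t) * ∏ k, X (t k) := by
  classical
  have hS : ∃ T : (Fin m → V) → K, f = ∑ t, C (T t) * ∏ k, X (t k) := by
    have key : ∀ s : V →₀ ℕ, s.degree = m → ∃ t : Fin m → V, expo t = s := by
      intro s hs
      have hc : (Finsupp.toMultiset s).card = m := by
        rw [Finsupp.card_toMultiset, ← hs]; rfl
      obtain ⟨l, hl⟩ := Quot.exists_rep (Finsupp.toMultiset s)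
      have hl' : l.length = m := by rw [← hc, ← hl]; rfl
      subst hl'
      refine ⟨l.get, ?_⟩
      have : Finsupp.toMultiset (expo l.get) = Finsupp.toMultiset s := by
        rw [← hl, expo, map_sum]
        simp only [Finsupp.toMultiset_single, one_smul]
        have h2 : ∀ l : List V, ∑ k, ({l.get k} : Multiset V) = (l : Multiset V) := by
          intro l
          induction l with
          | nil => rfl
          | cons a l ih =>
            simp only [List.length_cons]
            rw [Fin.sum_univ_succ]
            simp only [List.get_cons_zero, List.get_cons_succ', ih]
            rfl
        exact h2 l
      exact Multiset.toFinsupp.symm.injective this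
    have key2 : ∀ s : f.support, ∃ t : Fin m → V, expo t = s.1 := by
      intro s
      refine key s.1 ?_
      rw [← hf (mem_support_iff.1 s.2)]
      simp [Finsupp.weight_apply, Finsupp.degree, Finsupp.sum]
      rfl
    choose tt htt using key2
    refine ⟨fun t => ∑ s : f.support, if t = tt s then coeff s.1 f else 0, ?_⟩
    simp only [map_sum, Finset.sum_mul]
    rw [Finset.sum_comm]
    conv_lhs => rw [f.as_sum, ← Finset.sum_coe_sort]
    refine Finset.sum_congr rfl fun s hs => ?_
    rw [Finset.sum_eq_single (tt s)]
    · rw [if_pos rfl, prod_X_eq, htt s, C_mul_monomial, mul_one]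
    · intro t _ ht; simp [ht]
    · simp
  obtain ⟨T, hT⟩ := hS
  have hm : ((Fintype.card (Perm (Fin m)) : ℕ) : K) ≠ 0 := by
    exact_mod_cast Fintype.card_ne_zero
  refine ⟨fun t => ((Fintype.card (Perm (Fin m)) : ℕ) : K)⁻¹ * ∑ π : Perm (Fin m), T (t ∘ π),
    fun t ρ => ?_, ?_⟩
  · dsimp only
    congr 1
    refine Fintype.sum_equiv (Equiv.mulLeft ρ) _ _ fun π => ?_
    rfl
  · have hp : ∀ π : Perm (Fin m), ∑ t : Fin m → V, C (T (t ∘ π)) * ∏ k, X (t k) = f := by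
      intro π
      rw [hT]
      refine Fintype.sum_equiv (Equiv.arrowCongr π.symm (Equiv.refl _)) _ _ fun t => ?_
      have h1 : (Equiv.arrowCongr π.symm (Equiv.refl _) t : Fin m → V) = t ∘ π := by
        funext k; simp [Equiv.arrowCongr]
      rw [h1]
      congr 1
      exact (Equiv.prod_comp π fun k => (X (t k) : MvPolynomial V K)).symm
    simp only [map_mul, map_sum, mul_assoc, Finset.sum_mul]
    rw [← Finset.mul_sum, Finset.sum_comm, Finset.sum_congr rfl fun π _ => hp π]
    rw [Finset.sum_const, Finset.card_univ, ← Nat.cast_smul_eq_nsmul K, smul_eq_C_mul]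
    rw [← mul_assoc, ← C_mul, inv_mul_cancel₀ hm, C_1, one_mul]

/-- uniqueness of symmetric tensors -/
theorem tensor_unique {V K : Type*} [Fintype V] [Field K] [CharZero K] {m : ℕ}
    (T : (Fin m → V) → K) (hs : ∀ t (π : Perm (Fin m)), T (t ∘ π) = T t)
    (h : ∑ t, C (T t) * ∏ k, (X (t k) : MvPolynomial V K) = 0) : T = 0 := by
  classical
  funext t0
  obtain ⟨Φ, hΦ⟩ := exists_phi (V := V) (K := K) (m := m)
    (fun t => ∑ π : Perm (Fin m), if t ∘ π = t0 then 1 else 0) (by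
      intro t ρ
      refine Fintype.sum_equiv (Equiv.mulLeft ρ) _ _ fun π => rfl)
  have h1 := congrArg Φ h
  simp only [map_sum, ← smul_eq_C_mul, map_smul, hΦ, map_zero, smul_eq_mul] at h1
  simp only [Finset.mul_sum] at h1
  rw [Finset.sum_comm] at h1
  have h2 : ∀ π : Perm (Fin m), ∑ t : Fin m → V, T t * (if t ∘ π = t0 then 1 else 0) = T t0 := by
    intro π
    rw [Finset.sum_eq_single (t0 ∘ π.symm)]
    · rw [if_pos (by funext k; simp), mul_one, hs]
    · intro t _ ht
      rw [if_neg, mul_zero]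
      rintro rfl
      exact ht (by funext k; simp)
    · simp
  rw [Finset.sum_congr rfl fun π _ => h2 π, Finset.sum_const, Finset.card_univ, nsmul_eq_mul] at h1
  have hm : ((Fintype.card (Perm (Fin m)) : ℕ) : K) ≠ 0 := by
    exact_mod_cast Fintype.card_ne_zero
  exact (mul_eq_zero.1 h1).resolve_left hm

end Tensor
end
end

section
noncomputable section
section FFT
open Equiv

/-- double centralizer for a finite group of matrices -/
theorem double_centralizer {X G K : Type*} [Fintype X] [DecidableEq X] [Group G] [Fintype G]
    [Field K] [CharZero K] (P : G →* Matrix X X K) (T : Matrix X X K)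
    (hT : ∀ E : Matrix X X K, (∀ g, E * P g = P g * E) → T * E = E * T) :
    T ∈ Submodule.span K (Set.range P) := by
  classical
  set U := Submodule.span K (Set.range P) with hU
  obtain ⟨p0, hp0⟩ := LinearMap.exists_extend (LinearMap.id : U →ₗ[K] U)
  have hG : ((Fintype.card G : ℕ) : K) ≠ 0 := by exact_mod_cast Fintype.card_ne_zero
  have hUm : ∀ g, ∀ u ∈ U, P g * u ∈ U := by
    intro g u hu
    induction hu using Submodule.span_induction with
    | mem x hx =>
      obtain ⟨h, rfl⟩ := hx
      rw [← map_mul]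
      exact Submodule.subset_span ⟨_, rfl⟩
    | zero => simp
    | add x y _ _ hx hy => rw [mul_add]; exact U.add_mem hx hy
    | smul a x _ hx => rw [Matrix.mul_smul]; exact U.smul_mem _ hx
  have hp0' : ∀ u (hu : u ∈ U), (p0 u : Matrix X X K) = u := by
    intro u hu
    have := congrArg Subtype.val (LinearMap.congr_fun hp0 ⟨u, hu⟩)
    simpa using this
  let p : Matrix X X K → Matrix X X K := fun M =>
    ((Fintype.card G : ℕ) : K)⁻¹ • ∑ g, P g * (p0 (P g⁻¹ * M) : Matrix X X K)
  have padd : ∀ M N, p (M + N) = p M + p N := by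
    intro M N
    simp only [p, mul_add, map_add, Submodule.coe_add, Finset.sum_add_distrib, smul_add]
  have psmul : ∀ (a : K) M, p (a • M) = a • p M := by
    intro a M
    simp only [p, Matrix.mul_smul, map_smul, Submodule.coe_smul, ← Finset.smul_sum]
    rw [smul_comm]
  have pU : ∀ M, p M ∈ U := fun M =>
    U.smul_mem _ (U.sum_mem fun g _ => hUm g _ (p0 _).2)
  have pid : ∀ u ∈ U, p u = u := by
    intro u hu
    simp only [p]
    rw [Finset.sum_congr rfl (g := fun _ => u)]
    · rw [Finset.sum_const, Finset.card_univ, ← Nat.cast_smul_eq_nsmul K, smul_smul,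
        inv_mul_cancel₀ hG, one_smul]
    · intro g _
      rw [hp0' _ (hUm _ _ hu), ← mul_assoc, ← map_mul]
      simp
  have pmul : ∀ h M, p (P h * M) = P h * p M := by
    intro h M
    simp only [p, Matrix.mul_smul, Finset.mul_sum]
    congr 1
    refine (Fintype.sum_equiv (Equiv.mulLeft h) _ _ fun g => ?_).symm
    simp only [Equiv.coe_mulLeft, map_mul, _root_.mul_inv_rev, mul_assoc]
    congr 3
    rw [← mul_assoc (P h⁻¹), ← map_mul]
    simp
  let pl : Matrix X X K →ₗ[K] Matrix X X K := ⟨⟨p, padd⟩, psmul⟩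
  -- the components
  let E : X → X → Matrix X X K := fun c d => Matrix.of fun r s => p (Matrix.single s c 1) r d
  have hmulE : ∀ (M : Matrix X X K) c d r s', (E c d * M) r s' = p (M * Matrix.single s' c 1) r d := by
    intro M c d r s'
    have h1 : M * Matrix.single s' c 1 = ∑ s, M s s' • Matrix.single s c (1 : K) := by
      ext i j
      rw [Matrix.sum_apply]
      simp only [Matrix.smul_apply, Matrix.single_apply, Matrix.mul_apply]
      rw [Finset.sum_eq_single s' (fun b _ hb => by simp [Ne.symm hb]) (by simp)]
      rw [Finset.sum_eq_single i (fun b _ hb => by simp [hb]) (by simp)]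
      simp
    have h2 : p (M * Matrix.single s' c 1) = ∑ s, M s s' • p (Matrix.single s c (1 : K)) := by
      rw [h1]
      change pl _ = ∑ s, M s s' • pl _
      rw [map_sum]
      exact Finset.sum_congr rfl fun s _ => map_smul _ _ _
    rw [h2, Matrix.sum_apply, Matrix.mul_apply]
    refine Finset.sum_congr rfl fun s _ => ?_
    simp [E, mul_comm]
  have hEmul : ∀ (M : Matrix X X K) c d r s', (M * E c d) r s' = (M * p (Matrix.single s' c 1)) r d := by
    intro M c d r s'
    simp [Matrix.mul_apply, E]
  have hcomm : ∀ c d, T * E c d = E c d * T := by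
    intro c d
    refine hT _ fun g => ?_
    ext r s
    rw [hmulE, hEmul, pmul]
  have hpT : p T = T := by
    have h1 : (1 : Matrix X X K) = ∑ c, Matrix.single c c 1 := by
      rw [Matrix.sum_single_one]
    have h2 : ∀ c, p (T * Matrix.single c c 1) = T * p (Matrix.single c c 1) := by
      intro c
      ext r d
      rw [← hmulE, ← hEmul, hcomm]
    have h3 : p 1 = 1 := pid _ (Submodule.subset_span ⟨1, map_one P⟩)
    calc p T = pl (T * ∑ c, Matrix.single c c 1) := by rw [← h1, mul_one]; rfl
      _ = ∑ c, p (T * Matrix.single c c 1) := by rw [Finset.mul_sum, map_sum]; rfl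
      _ = ∑ c, T * p (Matrix.single c c 1) := Finset.sum_congr rfl fun c _ => h2 c
      _ = T * pl (∑ c, Matrix.single c c 1) := by rw [map_sum, Finset.mul_sum]; rfl
      _ = T * p 1 := by rw [← h1]; rfl
      _ = T := by rw [h3, mul_one]
  rw [← hpT]
  exact pU T

end FFT
end
end

section
noncomputable section
section FFT2
open Equiv

def vr (b : Bool) (i j : Fin 4) : MatVar 4 := if b then Sum.inr (i, j) else Sum.inl (i, j)

theorem mat_single (K : Type*) [Field K] (b : Bool) (i j : Fin 4) : mat K [b] i j = X (vr b i j) := by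
  cases b <;> simp [mat, vr, genX, genY]

def vrEquiv (m : ℕ) : (Fin m → Bool) × (Fin m → Fin 4) × (Fin m → Fin 4) ≃ (Fin m → MatVar 4) where
  toFun t := fun k => vr (t.1 k) (t.2.1 k) (t.2.2 k)
  invFun s := (fun k => (s k).isRight, fun k => (Sum.elim id id (s k)).1, fun k => (Sum.elim id id (s k)).2)
  left_inv t := by
    obtain ⟨b, i, j⟩ := t
    refine Prod.ext ?_ (Prod.ext ?_ ?_) <;> funext k <;> cases h : b k <;> simp [vr, h]
  right_inv s := by
    funext k
    rcases h : s k with ⟨i, j⟩ | ⟨i, j⟩ <;> simp [vr, h]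

theorem linear_subst {V K : Type*} [Fintype V] [Field K] [CharZero K] {m : ℕ}
    (T : (Fin m → V) → K) (hs : ∀ t (π : Perm (Fin m)), T (t ∘ π) = T t) (M : V → V → K)
    (h : aeval (fun v => ∑ v', C (M v v') * (X v' : MvPolynomial V K))
      (∑ t, C (T t) * ∏ k, (X (t k) : MvPolynomial V K)) = ∑ t, C (T t) * ∏ k, X (t k)) (t' : Fin m → V) :
    ∑ t, T t * ∏ k, M (t k) (t' k) = T t' := by
  classical
  have h1 : aeval (fun v => ∑ v', C (M v v') * (X v' : MvPolynomial V K))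
      (∑ t, C (T t) * ∏ k, (X (t k) : MvPolynomial V K)) =
      ∑ t' : Fin m → V, C (∑ t, T t * ∏ k, M (t k) (t' k)) * ∏ k, X (t' k) := by
    simp only [map_sum, map_mul, map_prod, aeval_X, algHom_C, Finset.prod_univ_sum,
      Fintype.piFinset_univ, Finset.mul_sum, Finset.sum_mul, Finset.prod_mul_distrib]
    rw [Finset.sum_comm]
    refine Finset.sum_congr rfl fun t' _ => Finset.sum_congr rfl fun t _ => ?_
    simp [algebraMap_eq, mul_assoc]
  rw [h1, ← sub_eq_zero, ← Finset.sum_sub_distrib] at h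
  simp only [← sub_mul, ← C_sub] at h
  have h2 := tensor_unique (fun t' => (∑ t, T t * ∏ k, M (t k) (t' k)) - T t') (by
    intro t π
    rw [hs]
    congr 1
    refine Fintype.sum_equiv (Equiv.arrowCongr π (Equiv.refl _)) _ _ fun s => ?_
    have h3 : (Equiv.arrowCongr π (Equiv.refl _) s : Fin m → V) = s ∘ π.symm := by
      funext k; simp [Equiv.arrowCongr]
    rw [h3, hs]
    congr 1
    refine Fintype.prod_equiv π _ _ fun k => by simp) h
  exact sub_eq_zero.1 (congrFun h2 t')

/-- Kronecker power -/
def kp {K : Type*} [CommRing K] (m : ℕ) (g : Matrix (Fin 4) (Fin 4) K) :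
    Matrix (Fin m → Fin 4) (Fin m → Fin 4) K := Matrix.of fun i p => ∏ k, g (i k) (p k)

theorem kp_mul {K : Type*} [CommRing K] (m : ℕ) (g h : Matrix (Fin 4) (Fin 4) K) :
    kp m (g * h) = kp m g * kp m h := by
  ext i j
  simp only [kp, Matrix.of_apply, Matrix.mul_apply, Finset.prod_univ_sum, Fintype.piFinset_univ,
    Finset.prod_mul_distrib]

theorem kp_one {K : Type*} [CommRing K] (m : ℕ) : kp m (1 : Matrix (Fin 4) (Fin 4) K) = 1 := by
  ext i j
  simp only [kp, Matrix.of_apply, Matrix.one_apply]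
  rw [Finset.prod_ite_zero]
  simp [funext_iff]

theorem kp_transpose {K : Type*} [CommRing K] (m : ℕ) (g : Matrix (Fin 4) (Fin 4) K) :
    (kp m g)ᵀ = kp m gᵀ := by
  ext i j; simp [kp]

def permMat (K : Type*) [Field K] (m : ℕ) : Perm (Fin m) →* Matrix (Fin m → Fin 4) (Fin m → Fin 4) K where
  toFun g := Matrix.of fun i j => if i ∘ g = j then 1 else 0
  map_one' := by ext i j; simp [Matrix.one_apply]
  map_mul' g h := by
    ext i j
    simp only [Matrix.mul_apply, Matrix.of_apply]
    rw [Finset.sum_eq_single (i ∘ g) (fun b _ hb => by simp [Ne.symm hb]) (by simp)]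
    simp only [if_true, one_mul, Function.comp_assoc, Perm.coe_mul]
    congr

theorem comm_kp_span {K : Type*} [Field K] [CharZero K] (m : ℕ)
    (T : Matrix (Fin m → Fin 4) (Fin m → Fin 4) K)
    (hT : ∀ g : Matrix (Fin 4) (Fin 4) K, g.det ≠ 0 → T * kp m g = kp m g * T) :
    T ∈ Submodule.span K (Set.range (permMat K m)) := by
  classical
  refine double_centralizer _ _ fun E hE => ?_
  have hE' : ∀ i j (π : Perm (Fin m)), E (i ∘ π) (j ∘ π) = E i j := by
    intro i j π
    have := congrFun (congrFun (hE π) i) (j ∘ π)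
    simp only [permMat, Matrix.mul_apply, MonoidHom.coe_mk, OneHom.coe_mk, Matrix.of_apply] at this
    rw [Finset.sum_eq_single j, Finset.sum_eq_single (i ∘ π)] at this
    · simpa using this.symm
    · intro b _ hb; simp [Ne.symm hb]
    · simp
    · intro b _ hb
      rw [if_neg, mul_zero]
      intro h
      apply hb
      funext k
      have := congrFun h (π.symm k)
      simpa using this
    · simp
  ext p q
  let Q : MvPolynomial (Fin 4 × Fin 4) K := ∑ j : Fin m → Fin 4, C (T p j) * ∏ k, X (j k, q k) -
    ∑ i : Fin m → Fin 4, C (T i q) * ∏ k, X (p k, i k)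
  have hQ : Q = 0 := by
    have h1 : Q * (Matrix.mvPolynomialX (Fin 4) (Fin 4) K).det = 0 := by
      refine MvPolynomial.funext fun h => ?_
      rw [map_mul, map_zero]
      let g : Matrix (Fin 4) (Fin 4) K := Matrix.of fun i j => h (i, j)
      have h2 : eval h (Matrix.mvPolynomialX (Fin 4) (Fin 4) K).det = g.det := by
        rw [RingHom.map_det]
        congr 1
        ext i j
        simp [g, Matrix.mvPolynomialX]
      rw [h2]
      by_cases hg : g.det = 0
      · rw [hg, mul_zero]
      · have h3 := congrFun (congrFun (hT g hg) p) q
        simp only [Matrix.mul_apply, kp, g, Matrix.of_apply] at h3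
        rw [mul_eq_zero]; left
        simp only [Q, map_sub, map_sum, map_mul, map_prod, eval_C, eval_X]
        rw [h3, sub_eq_zero]
        exact Finset.sum_congr rfl fun _ _ => mul_comm _ _
    exact (mul_eq_zero.1 h1).resolve_right (Matrix.det_mvPolynomialX_ne_zero _ _)
  obtain ⟨Φ, hΦ⟩ := exists_phi (V := Fin 4 × Fin 4) (K := K) (m := m)
    (fun t => E (fun k => (t k).1) (fun k => (t k).2)) (fun t π => hE' (fun k => (t k).1) (fun k => (t k).2) π)
  have h4 := congrArg Φ hQ
  simp only [Q, map_sub, map_sum, ← smul_eq_C_mul, map_smul, map_zero, smul_eq_mul] at h4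
  have h5 : ∀ j : Fin m → Fin 4, Φ (∏ k, X (j k, q k)) = E j q := fun j => hΦ fun k => (j k, q k)
  have h6 : ∀ i : Fin m → Fin 4, Φ (∏ k, X (p k, i k)) = E p i := fun i => hΦ fun k => (p k, i k)
  simp only [h5, h6] at h4
  rw [Matrix.mul_apply, Matrix.mul_apply, sub_eq_zero.1 h4]
  exact Finset.sum_congr rfl fun _ _ => mul_comm _ _


/-- the substitution of a conjugated pair -/
def conjM {K : Type*} [Field K] (g h : Matrix (Fin 4) (Fin 4) K) : MatVar 4 → MatVar 4 → K
  | Sum.inl v, Sum.inl v' => g v.1 v'.1 * h v'.2 v.2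
  | Sum.inr v, Sum.inr v' => g v.1 v'.1 * h v'.2 v.2
  | _, _ => 0

theorem conjM_vr {K : Type*} [Field K] (g h : Matrix (Fin 4) (Fin 4) K) (b b' : Bool) (i j p q : Fin 4) :
    conjM g h (vr b i j) (vr b' p q) = if b = b' then g i p * h q j else 0 := by
  cases b <;> cases b' <;> simp [vr, conjM]

def conjS {K : Type*} [Field K] (g h : Matrix (Fin 4) (Fin 4) K) (v : MatVar 4) :
    MvPolynomial (MatVar 4) K := ∑ v', C (conjM g h v v') * X v'

theorem conj_aeval {K : Type*} [Field K] [CharZero K] (f : MvPolynomial (MatVar 4) K)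
    (hf : IsMatInvariant f) (a : GL (Fin 4) K) :
    aeval (conjS (a : Matrix (Fin 4) (Fin 4) K) ((a⁻¹ : GL (Fin 4) K) : Matrix (Fin 4) (Fin 4) K)) f = f := by
  refine MvPolynomial.funext fun x => ?_
  let A : Matrix (Fin 4) (Fin 4) K := Matrix.of fun i j => x (Sum.inl (i, j))
  let B : Matrix (Fin 4) (Fin 4) K := Matrix.of fun i j => x (Sum.inr (i, j))
  have hx : x = pairSub A B := by
    funext v; rcases v with ⟨i, j⟩ | ⟨i, j⟩ <;> rfl
  conv_rhs => rw [hx, ← hf a A B]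
  rw [← MvPolynomial.coe_aeval_eq_eval, ← MvPolynomial.coe_aeval_eq_eval]
  change (aeval x) ((aeval _) f) = aeval _ f
  rw [← AlgHom.comp_apply, MvPolynomial.comp_aeval]
  congr 2
  funext v
  rcases v with ⟨i, j⟩ | ⟨i, j⟩
  · simp only [conjS, map_sum, map_mul, aeval_X, algHom_C, Fintype.sum_sum_type, conjM, pairSub,
      Fintype.sum_prod_type, Matrix.mul_apply, Finset.sum_mul, map_zero, zero_mul,
      Finset.sum_const_zero, add_zero]
    rw [Finset.sum_comm]
    refine Finset.sum_congr rfl fun p _ => Finset.sum_congr rfl fun q _ => ?_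
    simp [A]; ring
  · simp only [conjS, map_sum, map_mul, aeval_X, algHom_C, Fintype.sum_sum_type, conjM, pairSub,
      Fintype.sum_prod_type, Matrix.mul_apply, Finset.sum_mul, map_zero, zero_mul,
      Finset.sum_const_zero, zero_add]
    rw [Finset.sum_comm]
    refine Finset.sum_congr rfl fun p _ => Finset.sum_congr rfl fun q _ => ?_
    simp [B]; ring

theorem conjS_hom {K : Type*} [Field K] (g h : Matrix (Fin 4) (Fin 4) K) (v : MatVar 4) :
    (conjS g h v).IsHomogeneous 1 := by
  refine IsHomogeneous.sum _ _ _ fun v' _ => ?_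
  simpa using (isHomogeneous_C _ (conjM g h v v')).mul (isHomogeneous_X K v')

theorem conj_aeval_comp {K : Type*} [Field K] [CharZero K] (f : MvPolynomial (MatVar 4) K)
    (hf : IsMatInvariant f) (a : GL (Fin 4) K) (m : ℕ) :
    aeval (conjS (a : Matrix (Fin 4) (Fin 4) K) ((a⁻¹ : GL (Fin 4) K) : Matrix (Fin 4) (Fin 4) K))
      (homogeneousComponent m f) = homogeneousComponent m f := by
  have hm : ∀ n, (aeval (conjS (a : Matrix (Fin 4) (Fin 4) K)
      ((a⁻¹ : GL (Fin 4) K) : Matrix (Fin 4) (Fin 4) K)) (homogeneousComponent n f)).IsHomogeneous n := by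
    intro n
    have := (homogeneousComponent_isHomogeneous n f).aeval _ (fun v =>
      conjS_hom (a : Matrix (Fin 4) (Fin 4) K) ((a⁻¹ : GL (Fin 4) K) : Matrix (Fin 4) (Fin 4) K) v)
    simpa using this
  have h1 := conj_aeval f hf a
  conv_rhs => rw [← h1]
  conv_rhs => rw [← sum_homogeneousComponent f, map_sum, map_sum]
  simp only [homogeneousComponent_of_mem ((mem_homogeneousSubmodule _ _).2 (hm _))]
  rw [Finset.sum_ite_eq]
  split_ifs with h
  · rfl
  · rw [homogeneousComponent_eq_zero, map_zero]
    simpa using h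

theorem fft (K : Type*) [Field K] [CharZero K] (S : Subalgebra K (MvPolynomial (MatVar 4) K))
    (hS : ∀ w : List Bool, trw K w ∈ S) : pureAlg K 4 ≤ S := by
  classical
  intro f hf
  change IsMatInvariant f at hf
  rw [← sum_homogeneousComponent f]
  refine S.sum_mem fun m _ => ?_
  obtain ⟨T, hTs, hT⟩ := exists_tensor _ (homogeneousComponent_isHomogeneous m f)
  have hc : ∀ (a : GL (Fin 4) K) t', ∑ t, T t * ∏ k, conjM (a : Matrix (Fin 4) (Fin 4) K)
      ((a⁻¹ : GL (Fin 4) K) : Matrix (Fin 4) (Fin 4) K) (t k) (t' k) = T t' := by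
    intro a
    refine linear_subst T hTs _ ?_
    rw [← hT]
    exact conj_aeval_comp f hf a m
  let Tb : (Fin m → Bool) → Matrix (Fin m → Fin 4) (Fin m → Fin 4) K := fun b =>
    Matrix.of fun i j => T (vrEquiv m (b, i, j))
  have hTb : ∀ b (a : GL (Fin 4) K), (kp m (a : Matrix (Fin 4) (Fin 4) K))ᵀ * Tb b *
      (kp m ((a⁻¹ : GL (Fin 4) K) : Matrix (Fin 4) (Fin 4) K))ᵀ = Tb b := by
    intro b a
    ext p q
    have h1 := hc a (vrEquiv m (b, p, q))
    rw [← (vrEquiv m).sum_comp, Fintype.sum_prod_type] at h1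
    rw [Finset.sum_eq_single b] at h1
    · simp only [Tb, Matrix.of_apply]
      rw [← h1, Fintype.sum_prod_type, Finset.sum_comm]
      simp only [Matrix.mul_apply, Finset.sum_mul, Matrix.transpose_apply, kp, Matrix.of_apply]
      refine Finset.sum_congr rfl fun j _ => Finset.sum_congr rfl fun i _ => ?_
      simp only [vrEquiv, Equiv.coe_fn_mk, conjM_vr, if_true, Finset.prod_mul_distrib]
      ring
    · intro b' _ hb
      refine Finset.sum_eq_zero fun ij _ => ?_
      obtain ⟨k, hk⟩ := Function.ne_iff.1 hb
      rw [Finset.prod_eq_zero (Finset.mem_univ k), mul_zero]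
      simp only [vrEquiv, Equiv.coe_fn_mk, conjM_vr, if_neg hk]
    · simp
  have hspan : ∀ b, Tb b ∈ Submodule.span K (Set.range (permMat K m)) := by
    intro b
    refine comm_kp_span m _ fun g hg => ?_
    let a : GL (Fin 4) K := Matrix.GeneralLinearGroup.mkOfDetNeZero gᵀ (by rwa [Matrix.det_transpose])
    have ha : (a : Matrix (Fin 4) (Fin 4) K) = gᵀ := rfl
    have h1 := hTb b a
    have h2 : (kp m ((a⁻¹ : GL (Fin 4) K) : Matrix (Fin 4) (Fin 4) K))ᵀ *
        (kp m (a : Matrix (Fin 4) (Fin 4) K))ᵀ = 1 := by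
      rw [← Matrix.transpose_mul, ← kp_mul, ← Units.val_mul, mul_inv_cancel, Units.val_one, kp_one,
        Matrix.transpose_one]
    have h3 : (kp m (a : Matrix (Fin 4) (Fin 4) K))ᵀ = kp m g := by
      rw [kp_transpose, ha, Matrix.transpose_transpose]
    rw [← h3]
    conv_lhs => rw [← h1]
    rw [mul_assoc, h2, mul_one]
  have hcoef : ∀ b, ∃ c : Perm (Fin m) → K, ∑ ρ, c ρ • permMat K m ρ = Tb b := fun b =>
    (Submodule.mem_span_range_iff_exists_fun K).1 (hspan b)
  choose c hcc using hcoef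
  rw [hT, ← (vrEquiv m).sum_comp, Fintype.sum_prod_type]
  refine S.sum_mem fun b _ => ?_
  have h4 : ∑ ij : (Fin m → Fin 4) × (Fin m → Fin 4), C (T (vrEquiv m (b, ij))) *
      ∏ k, (X (vrEquiv m (b, ij) k) : MvPolynomial (MatVar 4) K) =
      ∑ ρ, C (c b ρ) * ptr ρ (fun k => mat K [b k]) := by
    have h5 : ∀ ij : (Fin m → Fin 4) × (Fin m → Fin 4), T (vrEquiv m (b, ij)) =
        ∑ ρ : Perm (Fin m), c b ρ * if ij.1 ∘ ρ = ij.2 then 1 else 0 := by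
      intro ij
      have := congrFun (congrFun (hcc b) ij.1) ij.2
      simp only [Tb, Matrix.of_apply] at this
      rw [← this, Matrix.sum_apply]
      rfl
    simp only [h5, map_sum, Finset.sum_mul]
    rw [Finset.sum_comm]
    refine Finset.sum_congr rfl fun ρ _ => ?_
    rw [ptr_eq, Finset.mul_sum, Fintype.sum_prod_type]
    refine Finset.sum_congr rfl fun i _ => ?_
    rw [Finset.sum_eq_single (i ∘ ρ) (fun j _ hj => by simp [Ne.symm hj]) (by simp)]
    simp [mat_single, vrEquiv]
  rw [h4]
  refine S.sum_mem fun ρ _ => S.mul_mem (S.algebraMap_mem _) ?_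
  exact ptr_mem K S m (fun w _ => hS w) (Fin m) ρ (fun k => [b k]) (by simp)

theorem trw_mem_pure (K : Type*) [Field K] (w : List Bool) : trw K w ∈ pureAlg K 4 := by
  intro a A B
  have h1 : ∀ A B : Matrix (Fin 4) (Fin 4) K, eval (pairSub A B) (trw K w) =
      ((w.map fun b : Bool => if b then B else A).prod).trace := by
    intro A B
    have h2 : ∀ w, (mat K w).map (eval (pairSub A B)) = (w.map fun b : Bool => if b then B else A).prod := by
      intro w
      induction w with
      | nil => simp [mat, Matrix.map_one]
      | cons b w ih =>
        have : mat K (b :: w) = (if b then genY K 4 else genX K 4) * mat K w := by simp [mat]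
        rw [this, Matrix.map_mul, ih, List.map_cons, List.prod_cons]
        congr 1
        cases b <;> · ext i j; simp [genX, genY, pairSub]
    rw [← h2, trw, Matrix.trace, Matrix.trace, map_sum]
    rfl
  rw [h1, h1]
  have h3 : (w.map fun b : Bool => if b then (a : Matrix (Fin 4) (Fin 4) K) * B * ((a⁻¹ : GL (Fin 4) K) : Matrix (Fin 4) (Fin 4) K)
      else (a : Matrix (Fin 4) (Fin 4) K) * A * ((a⁻¹ : GL (Fin 4) K) : Matrix (Fin 4) (Fin 4) K)).prod =
      (a : Matrix (Fin 4) (Fin 4) K) * (w.map fun b : Bool => if b then B else A).prod *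
        ((a⁻¹ : GL (Fin 4) K) : Matrix (Fin 4) (Fin 4) K) := by
    clear h1
    induction w with
    | nil => simp only [List.map_nil, List.prod_nil, mul_one]; rw [← Units.val_mul]; simp
    | cons b w ih =>
      rw [List.map_cons, List.prod_cons, ih, List.map_cons, List.prod_cons]
      have h4 : ((a⁻¹ : GL (Fin 4) K) : Matrix (Fin 4) (Fin 4) K) * (a : Matrix (Fin 4) (Fin 4) K) = 1 := by
        rw [← Units.val_mul]; simp
      have h5 : ∀ Z W : Matrix (Fin 4) (Fin 4) K, ((a : Matrix (Fin 4) (Fin 4) K) * Z * ((a⁻¹ : GL (Fin 4) K) : Matrix (Fin 4) (Fin 4) K)) *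
          ((a : Matrix (Fin 4) (Fin 4) K) * W * ((a⁻¹ : GL (Fin 4) K) : Matrix (Fin 4) (Fin 4) K)) =
          (a : Matrix (Fin 4) (Fin 4) K) * (Z * W) * ((a⁻¹ : GL (Fin 4) K) : Matrix (Fin 4) (Fin 4) K) := by
        intro Z W
        calc _ = (a : Matrix (Fin 4) (Fin 4) K) * Z * (((a⁻¹ : GL (Fin 4) K) : Matrix (Fin 4) (Fin 4) K) *
            (a : Matrix (Fin 4) (Fin 4) K)) * W * ((a⁻¹ : GL (Fin 4) K) : Matrix (Fin 4) (Fin 4) K) := by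
              simp only [mul_assoc]
          _ = _ := by rw [h4]; simp only [mul_assoc, one_mul]
      cases b
      · exact h5 _ _
      · exact h5 _ _
  rw [h3, Matrix.trace_mul_comm, ← mul_assoc, ← Units.val_mul]
  rw [inv_mul_cancel, Units.val_one, one_mul]

end FFT2
end
end

section
noncomputable section
section Q4
open Equiv
variable {M : Type*} [AddCommGroup M]

def q2 (f : List Bool → M) (v a b : List Bool) : M := f (v ++ a ++ b) + f (v ++ b ++ a)
def q3 (f : List Bool → M) (v a b c : List Bool) : M :=
  q2 f (v ++ a) b c + q2 f (v ++ b) a c + q2 f (v ++ c) a b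
def q4 (f : List Bool → M) (v a b c d : List Bool) : M :=
  q3 f (v ++ a) b c d + q3 f (v ++ b) a c d + q3 f (v ++ c) a b d + q3 f (v ++ d) a b c

abbrev updz {α : Type*} [DecidableEq α] (z : Option α → List Bool) (q : α) : α → List Bool :=
  Function.update (z ∘ some) q (z none ++ z (some q))

/-- families of functionals with peeling rules -/
structure Peel (M : Type*) [AddCommGroup M] where
  lam : ∀ (α : Type) [Fintype α] [DecidableEq α], Perm α → (α → List Bool) → M
  ok : ∀ (α : Type) [Fintype α] [DecidableEq α], (α → List Bool) → Prop
  ok_upd : ∀ (α : Type) [Fintype α] [DecidableEq α] (z : Option α → List Bool) (q : α), ok _ z → ok α (updz z q)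
  lam_none : ∀ (α : Type) [Fintype α] [DecidableEq α] [Nonempty α] (z : Option α → List Bool)
    (e : Perm α), ok _ z → lam _ (swap none none * optionCongr e) z = 0
  lam_some : ∀ (α : Type) [Fintype α] [DecidableEq α] (z : Option α → List Bool)
    (e : Perm α) (q : α), ok _ z → lam _ (swap none (some q) * optionCongr e) z = lam _ e (updz z q)

def Peel.S (P : Peel M) (α : Type) [Fintype α] [DecidableEq α] (z : α → List Bool) : M :=
  ∑ σ : Perm α, ((Perm.sign σ : ℤˣ) : ℤ) • P.lam α σ z

theorem Peel.S_option (P : Peel M) (α : Type) [Fintype α] [DecidableEq α] [Nonempty α]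
    (z : Option α → List Bool) (hz : P.ok _ z) : P.S (Option α) z = - ∑ q, P.S α (updz z q) := by
  unfold Peel.S
  rw [← Perm.decomposeOption.symm.sum_comp, Fintype.sum_prod_type, Fintype.sum_option]
  simp only [Perm.decomposeOption_symm_apply]
  have h1 : ∀ e : Perm α, P.lam _ (swap none none * optionCongr e) z = 0 := fun e => P.lam_none α z e hz
  have h2 : ∀ (e : Perm α) q, P.lam _ (swap none (some q) * optionCongr e) z = P.lam _ e (updz z q) :=
    fun e q => P.lam_some α z e q hz
  simp only [h1, h2, smul_zero, Finset.sum_const_zero, zero_add]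
  rw [← Finset.sum_neg_distrib]
  refine Finset.sum_congr rfl fun q _ => ?_
  rw [← Finset.sum_neg_distrib]
  refine Finset.sum_congr rfl fun e _ => ?_
  rw [Perm.sign_mul, Perm.sign_swap (by simp), Equiv.optionCongr_sign]
  simp

abbrev Five := Option (Option (Option (Option Unit)))

def five (a b c d e : List Bool) : Five → List Bool
  | none => a
  | some none => b
  | some (some none) => c
  | some (some (some none)) => d
  | some (some (some (some _))) => e

theorem Peel.S_five (P : Peel M) (f : List Bool → M) (hf : ∀ z, P.ok Unit z → P.lam Unit 1 z = f (z ()))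
    (a b c d e : List Bool) (hz : P.ok _ (five a b c d e)) :
    P.S Five (five a b c d e) = q4 (fun w => f (w ++ e)) [] a b c d := by
  have h1 : ∀ z, P.ok _ z → P.S (Option Unit) z = - f (z none ++ z (some ())) := by
    intro z hz
    rw [P.S_option _ _ hz]
    have := hf _ (P.ok_upd _ z () hz)
    simp [Peel.S, Perm.sign_one, Subsingleton.elim (default : Perm Unit) 1, this]
  have h2 : ∀ z, P.ok _ z → P.S (Option (Option Unit)) z =
      q2 (fun w => f (w ++ z (some (some ())))) [] (z none) (z (some none)) := by
    intro z hz
    rw [P.S_option _ _ hz, Fintype.sum_option, h1 _ (P.ok_upd _ z _ hz), Fintype.sum_unique,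
      h1 _ (P.ok_upd _ z _ hz)]
    simp [q2, updz, Function.update]
    abel
  have h3 : ∀ z, P.ok _ z → P.S (Option (Option (Option Unit))) z =
      - q3 (fun w => f (w ++ z (some (some (some ()))))) [] (z none) (z (some none)) (z (some (some none))) := by
    intro z hz
    rw [P.S_option _ _ hz, Fintype.sum_option, Fintype.sum_option, Fintype.sum_unique,
      h2 _ (P.ok_upd _ z _ hz), h2 _ (P.ok_upd _ z _ hz), h2 _ (P.ok_upd _ z _ hz)]
    simp [q2, q3, updz, Function.update]
    abel
  rw [P.S_option _ _ hz, Fintype.sum_option, Fintype.sum_option, Fintype.sum_option, Fintype.sum_unique,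
    h3 _ (P.ok_upd _ _ _ hz), h3 _ (P.ok_upd _ _ _ hz), h3 _ (P.ok_upd _ _ _ hz), h3 _ (P.ok_upd _ _ _ hz)]
  simp [q2, q3, q4, updz, Function.update, five]
  abel

end Q4
end
end

section
noncomputable section
section Gen
open Equiv

def genPeel (K : Type*) [Field K] (A : Subalgebra K (MvPolynomial (MatVar 4) K)) (n : ℕ)
    (hA : ∀ w : List Bool, w.length < n → trw K w ∈ A) :
    Peel (MvPolynomial (MatVar 4) K ⧸ Subalgebra.toSubmodule A) where
  lam α _ _ σ z := Submodule.Quotient.mk (ptr σ fun k => mat K (z k))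
  ok α _ _ z := (∀ k, z k ≠ []) ∧ ∑ k, (z k).length = n
  ok_upd α _ _ z q h := by
    refine ⟨fun k => ?_, by rw [updz, sum_len_update]; exact h.2⟩
    by_cases hk : k = q
    · subst hk; simp [updz, h.1]
    · simp [updz, hk, h.1]
  lam_none α _ _ _ z e h := by
    rw [Submodule.Quotient.mk_eq_zero, ptr_none]
    have h2 := h.2
    rw [Fintype.sum_option] at h2
    have h3 : 0 < (z none).length := List.length_pos_iff.2 (h.1 _)
    have h4 : 0 < ∑ k, (z (some k)).length := by
      obtain ⟨k⟩ := ‹Nonempty α›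
      exact lt_of_lt_of_le (List.length_pos_iff.2 (h.1 (some k)))
        (Finset.single_le_sum (f := fun k => (z (some k)).length) (fun _ _ => Nat.zero_le _) (Finset.mem_univ k))
    refine A.mul_mem (hA _ (by omega)) ?_
    refine ptr_mem K A (n - 1) (fun w hw => hA w (by omega)) α e (z ∘ some) ?_
    simp only [Function.comp_apply]
    omega
  lam_some α _ _ z e q _ := by
    rw [ptr_some, mat_update]

theorem q4_quot (K : Type*) [Field K] (A : Subalgebra K (MvPolynomial (MatVar 4) K)) (n : ℕ)
    (hA : ∀ w : List Bool, w.length < n → trw K w ∈ A) (a b c d e : List Bool) (ha : a ≠ []) (hb : b ≠ [])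
    (hc : c ≠ []) (hd : d ≠ []) (he : e ≠ [])
    (hn : a.length + b.length + c.length + d.length + e.length = n) :
    q4 (fun w => (Submodule.Quotient.mk (trw K (w ++ e)) : MvPolynomial (MatVar 4) K ⧸ Subalgebra.toSubmodule A))
      [] a b c d = 0 := by
  rw [← (genPeel K A n hA).S_five (fun w => Submodule.Quotient.mk (trw K w))]
  · have h := fundamental (α := Five) (by simp) (fun k => mat K (five a b c d e k))
    have h2 := congrArg (Submodule.Quotient.mk (p := Subalgebra.toSubmodule A)) h
    rw [Submodule.Quotient.mk_zero, ← Submodule.mkQ_apply, map_sum] at h2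
    rw [← h2]
    refine Finset.sum_congr rfl fun σ _ => ?_
    rw [← zsmul_eq_mul, map_zsmul]
    rfl
  · intro z _
    change Submodule.Quotient.mk _ = _
    congr 1
    rw [ptr_eq, ← (Equiv.funUnique Unit (Fin 4)).symm.sum_comp]
    simp [trw, Matrix.trace]
  · refine ⟨?_, ?_⟩
    · rintro (_ | _ | _ | _ | _) <;> simpa [five]
    · simp only [Fintype.sum_option, five, Fintype.sum_unique]; omega

theorem q4_zero {M : Type*} [AddCommGroup M] (f : List Bool → M) (n : ℕ) (hf : ∀ w, w.length = n → f w = 0) (v a b c d : List Bool)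
    (h : v.length + a.length + b.length + c.length + d.length = n) : q4 f v a b c d = 0 := by
  simp only [q4, q3, q2]
  repeat rw [hf _ (by simp only [List.length_append]; omega)]
  simp

theorem q4_congr {M : Type*} [AddCommGroup M] (f g : List Bool → M) (n : ℕ) (hf : ∀ w, w.length = n → f w = g w) (v a b c d : List Bool)
    (h : v.length + a.length + b.length + c.length + d.length = n) : q4 f v a b c d = q4 g v a b c d := by
  simp only [q4, q3, q2]
  repeat rw [hf _ (by simp only [List.length_append]; omega)]

open Classical in
/-- induction step for generation, from an abstract vanishing result -/
theorem gen_of_abstract (K : Type*) [Field K] (A : Subalgebra K (MvPolynomial (MatVar 4) K))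
    (G : List (List Bool)) (hG : ∀ g ∈ G, trw K g ∈ A)
    (habs : ∀ (t : List Bool → MvPolynomial (MatVar 4) K ⧸ Subalgebra.toSubmodule A),
      (∀ u v, t (u ++ v) = t (v ++ u)) →
      (∀ a b c d e : List Bool, a ≠ [] → b ≠ [] → c ≠ [] → d ≠ [] → e ≠ [] →
        q4 (fun w => t (w ++ e)) [] a b c d = 0) →
      (∀ g ∈ G, t g = 0) → ∀ w, w ≠ [] → t w = 0) (w : List Bool) : trw K w ∈ A := by
  induction hn : w.length using Nat.strong_induction_on generalizing w with
  | _ n ih =>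
  have hA : ∀ w : List Bool, w.length < n → trw K w ∈ A := fun w hw => ih _ hw w rfl
  by_cases hw : w = []
  · subst hw
    have : trw K [] = algebraMap K _ 4 := by
      simp [trw, mat, Matrix.trace_one]
      exact (map_ofNat C 4).symm
    rw [this]
    exact A.algebraMap_mem _
  let t : List Bool → MvPolynomial (MatVar 4) K ⧸ Subalgebra.toSubmodule A := fun w =>
    if w.length = n then Submodule.Quotient.mk (trw K w) else 0
  have h := habs t ?_ ?_ ?_ w hw
  · simp only [t, hn, if_true] at h
    exact (Submodule.Quotient.mk_eq_zero _).1 h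
  · intro u v
    simp only [t, trw_cyc K u v, List.length_append, add_comm]
  · intro a b c d e ha hb hc hd he
    by_cases hl : a.length + b.length + c.length + d.length + e.length = n
    · rw [← q4_quot K A n hA a b c d e ha hb hc hd he hl]
      refine q4_congr _ _ (a.length + b.length + c.length + d.length) ?_ _ _ _ _ _ (by simp)
      intro w hw
      simp only [t]
      rw [if_pos (by simp only [List.length_append]; omega)]
    · refine q4_zero _ (a.length + b.length + c.length + d.length) ?_ _ _ _ _ _ (by simp)
      intro w hw
      simp only [t]
      rw [if_neg (by simp only [List.length_append]; omega)]
  · intro g hg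
    simp only [t]
    split_ifs
    · exact (Submodule.Quotient.mk_eq_zero _).2 (hG g hg)
    · rfl

end Gen
end
end

section
section Refl

/-- words are coded in binary with a leading one -/
def dec (c : ℕ) : List Bool := c.bits.reverse.tail

theorem dec_one : dec 1 = [] := by simp [dec]

theorem dec_bit (c : ℕ) (l : Bool) (hc : c ≠ 0) : dec (2 * c + l.toNat) = dec c ++ [l] := by
  have : 2 * c + l.toNat = Nat.bit l c := by cases l <;> simp [Nat.bit]
  rw [this]
  unfold dec
  rw [Nat.bits_append_bit _ _ (fun h => absurd h hc), List.reverse_cons, List.tail_append_of_ne_nil]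
  simp only [ne_eq, List.reverse_eq_nil_iff]
  intro h
  apply hc
  rw [← Nat.size_eq_zero, ← Nat.size_eq_bits_len, h]; rfl

abbrev PolyW := List (ℤ × ℕ)

inductive Trie where
  | leaf : Trie
  | node : Option (ℕ × PolyW) → Trie → Trie → Trie

def Trie.get : Trie → ℕ → Option (ℕ × PolyW)
  | .leaf, _ => none
  | .node o l r, c =>
    match Nat.ble c 1 with
    | true => o
    | false =>
      match Nat.beq (c % 2) 0 with
      | true => l.get (c / 2)
      | false => r.get (c / 2)

def Trie.find (t : Trie) (c : ℕ) : Option PolyW :=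
  match t.get c with
  | none => none
  | some x =>
    match Nat.beq x.1 c with
    | true => some x.2
    | false => none

def Trie.ins (x : ℕ × PolyW) : ℕ → Trie → ℕ → Trie
  | 0, t, _ => t
  | k + 1, .leaf, c =>
      match Nat.ble c 1 with
      | true => .node (some x) .leaf .leaf
      | false =>
        match Nat.beq (c % 2) 0 with
        | true => .node none (Trie.ins x k .leaf (c / 2)) .leaf
        | false => .node none .leaf (Trie.ins x k .leaf (c / 2))
  | k + 1, .node o l r, c =>
      match Nat.ble c 1 with
      | true => .node (some x) l r
      | false =>
        match Nat.beq (c % 2) 0 with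
        | true => .node o (Trie.ins x k l (c / 2)) r
        | false => .node o l (Trie.ins x k r (c / 2))

def Trie.All (P : ℕ × PolyW → Prop) : Trie → Prop
  | .leaf => True
  | .node o l r => (∀ x ∈ o, P x) ∧ l.All P ∧ r.All P

theorem Trie.All.get {P : ℕ × PolyW → Prop} {t : Trie} (ht : t.All P) {c : ℕ} {x} (h : t.get c = some x) : P x := by
  induction t generalizing c with
  | leaf => simp [Trie.get] at h
  | node o l r ihl ihr =>
    obtain ⟨h1, h2, h3⟩ := ht
    simp only [Trie.get] at h
    split at h
    · exact h1 x (by simp [h])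
    · split at h
      · exact ihl h2 h
      · exact ihr h3 h

theorem Trie.All.find {P : ℕ × PolyW → Prop} {t : Trie} (ht : t.All P) {c : ℕ} {q} (h : t.find c = some q) : P (c, q) := by
  unfold Trie.find at h
  split at h
  · simp at h
  · rename_i x hx
    split at h
    · rename_i hc
      have := ht.get hx
      simp only [Option.some.injEq] at h
      rw [Nat.beq_eq] at hc
      obtain ⟨x1, x2⟩ := x
      simp only at hc h
      rwa [← hc, ← h]
    · simp at h

theorem Trie.All.ins {P : ℕ × PolyW → Prop} {x} (hx : P x) (k : ℕ) {t : Trie} (ht : t.All P) (c : ℕ) :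
    (Trie.ins x k t c).All P := by
  induction k generalizing t c with
  | zero => simpa [Trie.ins]
  | succ k ih =>
    have hl : Trie.leaf.All P := trivial
    cases t with
    | leaf =>
      simp only [Trie.ins]
      split
      · exact ⟨by simpa using hx, hl, hl⟩
      · split
        · exact ⟨by simp, ih hl _, hl⟩
        · exact ⟨by simp, hl, ih hl _⟩
    | node o l r =>
      obtain ⟨h1, h2, h3⟩ := ht
      simp only [Trie.ins]
      split
      · exact ⟨by simpa using hx, h2, h3⟩
      · split
        · exact ⟨h1, ih h2 _, h3⟩
        · exact ⟨h1, h2, ih h3 _⟩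

def consT (c : ℤ) (b : ℕ) (p : PolyW) : PolyW := (c, b) :: p

/-- prepend `c` times `q` -/
def smulApp (c : ℤ) : PolyW → PolyW → PolyW
  | [], p => p
  | (d, b) :: q, p => (c * d, b) :: smulApp c q p

def mulL (t : Trie) (l : ℕ) : PolyW → PolyW
  | [] => []
  | (c, b) :: p =>
    match t.find (2 * b + l) with
    | none => (c, 2 * b + l) :: mulL t l p
    | some q => smulApp c q (mulL t l p)

def mulWd (t : Trie) : PolyW → List Bool → PolyW
  | p, [] => p
  | p, l :: w => mulWd t (mulL t l.toNat p) w

def q2p (t : Trie) (p : PolyW) (a b : List Bool) : PolyW :=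
  mulWd t (mulWd t p a) b ++ mulWd t (mulWd t p b) a
def q3p (t : Trie) (p : PolyW) (a b c : List Bool) : PolyW :=
  q2p t (mulWd t p a) b c ++ (q2p t (mulWd t p b) a c ++ q2p t (mulWd t p c) a b)
def q4p (t : Trie) (p : PolyW) (a b c d : List Bool) : PolyW :=
  q3p t (mulWd t p a) b c d ++ (q3p t (mulWd t p b) a c d ++ (q3p t (mulWd t p c) a b d ++ q3p t (mulWd t p d) a b c))

/-- decoding used for certificate data only -/
def dcd : ℕ → ℕ → List Bool → List Bool
  | 0, _, acc => acc
  | k + 1, c, acc =>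
    match Nat.ble c 1 with
    | true => acc
    | false => dcd k (c / 2) (Nat.beq (c % 2) 1 :: acc)
abbrev wd (c : ℕ) : List Bool := dcd 12 c []

def addT (c : ℤ) (b : ℕ) : PolyW → PolyW
  | [] => [(c, b)]
  | (d, b') :: p =>
    match Nat.beq b b' with
    | true => (c + d, b') :: p
    | false => (d, b') :: addT c b p

def collect : PolyW → PolyW → PolyW
  | [], acc => acc
  | (c, b) :: p, acc => collect p (addT c b acc)

def isZ : PolyW → Bool
  | [] => true
  | (c, _) :: p => match c with
    | .ofNat 0 => isZ p
    | _ => false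

section sound
variable {M : Type*} [AddCommGroup M] (T : List Bool → M)

def ev (p : PolyW) (e : List Bool) : M := (p.map fun x => x.1 • T (dec x.2 ++ e)).sum

theorem ev_nil (e : List Bool) : ev T [] e = 0 := rfl
theorem ev_cons (c b p) (e : List Bool) : ev T ((c, b) :: p) e = c • T (dec b ++ e) + ev T p e := by simp [ev]
theorem ev_append (p q) (e : List Bool) : ev T (p ++ q) e = ev T p e + ev T q e := by simp [ev]
theorem ev_smulApp (c q p) (e : List Bool) : ev T (smulApp c q p) e = c • ev T q e + ev T p e := by
  induction q with
  | nil => simp [smulApp, ev_nil]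
  | cons x q ih =>
    obtain ⟨d, b⟩ := x
    simp only [smulApp, ev_cons, ih, smul_add, mul_smul, add_assoc]
theorem ev_addT (c b p) (e : List Bool) : ev T (addT c b p) e = c • T (dec b ++ e) + ev T p e := by
  induction p with
  | nil => simp [addT, ev_cons]
  | cons x p ih =>
    obtain ⟨d, b'⟩ := x
    simp only [addT]
    split
    · rename_i h
      rw [Nat.beq_eq] at h
      subst h
      simp only [ev_cons, add_smul, add_assoc]
    · simp only [ev_cons, ih]; abel
theorem ev_collect (p acc) (e : List Bool) : ev T (collect p acc) e = ev T p e + ev T acc e := by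
  induction p generalizing acc with
  | nil => simp [collect, ev_nil]
  | cons x p ih =>
    obtain ⟨c, b⟩ := x
    simp only [collect, ih, ev_addT, ev_cons]; abel
theorem ev_isZ (p) (h : isZ p = true) (e : List Bool) : ev T p e = 0 := by
  induction p with
  | nil => rfl
  | cons x p ih =>
    obtain ⟨c, b⟩ := x
    simp only [isZ] at h
    split at h
    · rw [ev_cons, ih h]; simp
    · simp at h

/-- no zero codes -/
def NZ (p : PolyW) : Prop := ∀ x ∈ p, x.2 ≠ 0

def Valid (x : ℕ × PolyW) : Prop := NZ x.2 ∧ ∀ e : List Bool, e ≠ [] → T (dec x.1 ++ e) = ev T x.2 e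

theorem NZ_smulApp {c q p} (hq : NZ q) (hp : NZ p) : NZ (smulApp c q p) := by
  induction q with
  | nil => exact hp
  | cons x q ih =>
    obtain ⟨d, b⟩ := x
    simp only [NZ, List.forall_mem_cons] at hq
    simp only [smulApp, NZ, List.forall_mem_cons]
    exact ⟨hq.1, ih hq.2⟩

variable {T}
theorem mulL_spec {t : Trie} (ht : t.All (Valid T)) (l : Bool) (p : PolyW) (hp : NZ p) :
    NZ (mulL t l.toNat p) ∧ ∀ e : List Bool, e ≠ [] → ev T (mulL t l.toNat p) e = ev T p (l :: e) := by
  induction p with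
  | nil => exact ⟨hp, fun e _ => rfl⟩
  | cons x p ih =>
    obtain ⟨c, b⟩ := x
    simp only [NZ, List.forall_mem_cons] at hp
    obtain ⟨i1, i2⟩ := ih hp.2
    have hb : ∀ e, dec (2 * b + l.toNat) ++ e = dec b ++ l :: e := by
      intro e; rw [dec_bit b l hp.1]; simp
    simp only [mulL]
    split
    · refine ⟨?_, fun e he => ?_⟩
      · simp only [NZ, List.forall_mem_cons]
        exact ⟨by have := hp.1; omega, i1⟩
      · rw [ev_cons, ev_cons, i2 e he, hb]
    · rename_i q hq
      obtain ⟨v1, v2⟩ := ht.find hq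
      refine ⟨NZ_smulApp v1 i1, fun e he => ?_⟩
      rw [ev_smulApp, ← v2 e he, i2 e he, ev_cons, hb]

theorem mulWd_spec {t : Trie} (ht : t.All (Valid T)) (w : List Bool) (p : PolyW) (hp : NZ p) :
    NZ (mulWd t p w) ∧ ∀ e : List Bool, e ≠ [] → ev T (mulWd t p w) e = ev T p (w ++ e) := by
  induction w generalizing p with
  | nil => exact ⟨hp, fun e _ => rfl⟩
  | cons l w ih =>
    obtain ⟨h1, h2⟩ := mulL_spec ht l p hp
    obtain ⟨h3, h4⟩ := ih _ h1
    exact ⟨h3, fun e he => by rw [mulWd, h4 e he, h2 _ (by simp [he])]; rfl⟩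

theorem NZ_append {p q} (hp : NZ p) (hq : NZ q) : NZ (p ++ q) := by
  intro x hx
  rcases List.mem_append.1 hx with h | h
  · exact hp x h
  · exact hq x h

theorem q2p_spec {t : Trie} (ht : t.All (Valid T)) (p : PolyW) (hp : NZ p) (v a b e : List Bool) (he : e ≠ [])
    (g : List Bool → M) (hg : ∀ w, ev T p (w ++ e) = g (v ++ w)) :
    ev T (q2p t p a b) e = q2 g v a b := by
  have h := fun w p hp => (mulWd_spec ht w p hp)
  simp only [q2p, q2, ev_append]
  rw [(h b _ (h a p hp).1).2 e he, (h a p hp).2 _ (by simp [he]),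
    (h a _ (h b p hp).1).2 e he, (h b p hp).2 _ (by simp [he])]
  rw [← List.append_assoc a b e, hg, ← List.append_assoc b a e, hg]
  simp only [List.append_assoc]

theorem hg_step {t : Trie} (ht : t.All (Valid T)) (p : PolyW) (hp : NZ p) (v a e : List Bool) (he : e ≠ [])
    (g : List Bool → M) (hg : ∀ w, ev T p (w ++ e) = g (v ++ w)) (w : List Bool) :
    ev T (mulWd t p a) (w ++ e) = g (v ++ a ++ w) := by
  rw [(mulWd_spec ht a p hp).2 _ (by simp [he]), ← List.append_assoc, hg, List.append_assoc]

theorem q3p_spec {t : Trie} (ht : t.All (Valid T)) (p : PolyW) (hp : NZ p) (v a b c e : List Bool) (he : e ≠ [])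
    (g : List Bool → M) (hg : ∀ w, ev T p (w ++ e) = g (v ++ w)) :
    ev T (q3p t p a b c) e = q3 g v a b c := by
  have h := fun w => (mulWd_spec ht w p hp).1
  simp only [q3p, q3, ev_append]
  rw [q2p_spec ht _ (h a) (v ++ a) b c e he g (hg_step ht p hp v a e he g hg),
    q2p_spec ht _ (h b) (v ++ b) a c e he g (hg_step ht p hp v b e he g hg),
    q2p_spec ht _ (h c) (v ++ c) a b e he g (hg_step ht p hp v c e he g hg)]
  abel

theorem q4p_spec {t : Trie} (ht : t.All (Valid T)) (p : PolyW) (hp : NZ p) (v a b c d e : List Bool) (he : e ≠ [])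
    (g : List Bool → M) (hg : ∀ w, ev T p (w ++ e) = g (v ++ w)) :
    ev T (q4p t p a b c d) e = q4 g v a b c d := by
  have h := fun w => (mulWd_spec ht w p hp).1
  simp only [q4p, q4, ev_append]
  rw [q3p_spec ht _ (h a) (v ++ a) b c d e he g (hg_step ht p hp v a e he g hg),
    q3p_spec ht _ (h b) (v ++ b) a c d e he g (hg_step ht p hp v b e he g hg),
    q3p_spec ht _ (h c) (v ++ c) a b d e he g (hg_step ht p hp v c e he g hg),
    q3p_spec ht _ (h d) (v ++ d) a b c e he g (hg_step ht p hp v d e he g hg)]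
  abel

end sound

abbrev CertE := ℤ × ℕ × ℕ × ℕ × ℕ × ℕ
abbrev RuleE := ℕ × ℕ × PolyW × List CertE

def certP (t : Trie) : List CertE → PolyW
  | [] => []
  | (k, u, a, b, c, d) :: r =>
    smulApp k (q4p t (mulWd t [(1, 1)] (wd u)) (wd a) (wd b) (wd c) (wd d)) (certP t r)

def nzB : PolyW → Bool
  | [] => true
  | (_, b) :: p => !(Nat.beq b 0) && nzB p

def certOk : List CertE → Bool
  | [] => true
  | (_, _, a, b, c, d) :: r => !(wd a).isEmpty && !(wd b).isEmpty && !(wd c).isEmpty && !(wd d).isEmpty && certOk r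

def ruleOk (t : Trie) (r : RuleE) : Bool :=
  !(Nat.beq r.2.1 0) && nzB r.2.2.1 && certOk r.2.2.2 &&
    isZ (collect ((-(r.2.1 : ℤ), r.1) :: smulApp r.2.1 r.2.2.1 (certP t r.2.2.2)) [])

def build : List RuleE → Trie → Option Trie
  | [], t => some t
  | r :: rs, t =>
    match ruleOk t r with
    | true => build rs (Trie.ins (r.1, r.2.2.1) 12 t r.1)
    | false => none

/-- append the last letter and drop known zeros -/
def lastL (z : Trie) (l : ℕ) : PolyW → PolyW
  | [] => []
  | (c, b) :: p =>
    match z.find (2 * b + l) with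
    | none => (c, 2 * b + l) :: lastL z l p
    | some _ => lastL z l p

def tnf (t z : Trie) (v : List Bool) (l : Bool) : PolyW := lastL z l.toNat (mulWd t [(1, 1)] v)

/-- trace certificates: kind 0 and 1 are rotations by a letter, kind 2 generators -/
def tcertP (G : List ℕ) (t z : Trie) : List (ℤ × ℕ × ℕ) → Option PolyW
  | [] => some []
  | (k, j, c) :: r =>
    match tcertP G t z r with
    | none => none
    | some p =>
      match Nat.beq j 2 with
      | true =>
        match G.contains c with
        | true => some (smulApp k (tnf t z (wd c).dropLast ((wd c).getLastD false)) p)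
        | false => none
      | false =>
        some (smulApp k (tnf t z (wd c) (Nat.beq j 1))
          (smulApp (-k) (tnf t z (Nat.beq j 1 :: wd c).dropLast ((Nat.beq j 1 :: wd c).getLastD false)) p))

abbrev TRuleE := ℕ × ℕ × List (ℤ × ℕ × ℕ)

def tbuild (G : List ℕ) (t : Trie) : List TRuleE → Trie → Option Trie
  | [], z => some z
  | r :: rs, z =>
    match tcertP G t z r.2.2 with
    | none => none
    | some p =>
      match !(Nat.beq r.2.1 0) && isZ (collect ((-(r.2.1 : ℤ), r.1) :: p) []) with
      | true => tbuild G t rs (Trie.ins (r.1, []) 12 z r.1)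
      | false => none

def allZ (z : Trie) (l : ℕ) : PolyW → Bool
  | [] => true
  | (_, b) :: p => (z.find (2 * b + l)).isSome && allZ z l p

def fin (t z : Trie) : ℕ → PolyW → Bool
  | 0, p => p.isEmpty
  | k + 1, p => p.isEmpty || (allZ z 0 p && allZ z 1 p && fin t z k (mulL t 0 p) && fin t z k (mulL t 1 p))

def fullCheck (G : List ℕ) (R : List RuleE) (Q : List TRuleE) : Bool :=
  match build R .leaf with
  | none => false
  | some t =>
    match tbuild G t Q .leaf with
    | none => false
    | some z => fin t z 10 [(1, 1)]

section sound2
variable {K : Type*} [Field K] [CharZero K] {M : Type*} [AddCommGroup M] [Module K M] {T : List Bool → M}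

theorem tors (K : Type*) [Field K] [CharZero K] {M : Type*} [AddCommGroup M] [Module K M] (n : ℕ) (hn : n ≠ 0) (x : M)
    (h : (n : ℤ) • x = 0) : x = 0 := by
  rw [← Int.cast_smul_eq_zsmul K, smul_eq_zero] at h
  rcases h with h | h
  · exact absurd h (by exact_mod_cast hn)
  · exact h

theorem NZ_one : NZ [(1, 1)] := by simp [NZ]

theorem certP_spec {t : Trie} (ht : t.All (Valid T)) (hq : ∀ v a b c d e : List Bool, a ≠ [] → b ≠ [] → c ≠ [] → d ≠ [] →
    e ≠ [] → q4 (fun w => T (w ++ e)) v a b c d = 0) (r : List CertE) (hr : certOk r = true) (e : List Bool) (he : e ≠ []) :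
    ev T (certP t r) e = 0 := by
  induction r with
  | nil => rfl
  | cons x r ih =>
    obtain ⟨k, u, a, b, c, d⟩ := x
    simp only [certOk, Bool.and_eq_true, Bool.not_eq_true', List.isEmpty_eq_false_iff] at hr
    obtain ⟨⟨⟨⟨ha, hb⟩, hc⟩, hd⟩, hr⟩ := hr
    obtain ⟨h1, h2⟩ := mulWd_spec ht (wd u) _ NZ_one
    rw [certP, ev_smulApp, ih hr, q4p_spec ht _ h1 (wd u) _ _ _ _ e he (fun w => T (w ++ e)), hq _ _ _ _ _ _ ha hb hc hd he]
    · simp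
    · intro w
      rw [h2 _ (by simp [he]), ev_cons, ev_nil, dec_one]
      simp

theorem nzB_spec {p : PolyW} (h : nzB p = true) : NZ p := by
  induction p with
  | nil => simp [NZ]
  | cons x p ih =>
    obtain ⟨c, b⟩ := x
    simp only [nzB, Bool.and_eq_true, Bool.not_eq_true'] at h
    simp only [NZ, List.forall_mem_cons]
    refine ⟨?_, ih h.2⟩
    rintro rfl
    simp at h

include K in
theorem build_spec (hq : ∀ v a b c d e : List Bool, a ≠ [] → b ≠ [] → c ≠ [] → d ≠ [] →
    e ≠ [] → q4 (fun w => T (w ++ e)) v a b c d = 0) (R : List RuleE) (t t' : Trie) (ht : t.All (Valid T))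
    (h : build R t = some t') : t'.All (Valid T) := by
  induction R generalizing t with
  | nil => simp only [build, Option.some.injEq] at h; rwa [← h]
  | cons r R ih =>
    simp only [build] at h
    split at h
    · rename_i hr
      refine ih _ (Trie.All.ins ?_ _ ht _) h
      simp only [ruleOk, Bool.and_eq_true, Bool.not_eq_true'] at hr
      obtain ⟨⟨⟨h1, h2⟩, h3⟩, h4⟩ := hr
      refine ⟨nzB_spec h2, fun e he => ?_⟩
      have h5 := ev_isZ T _ h4 e
      rw [ev_collect, ev_nil, ev_cons, ev_smulApp, certP_spec ht hq _ h3 e he] at h5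
      rw [← sub_eq_zero]
      refine tors K r.2.1 (fun h => by simp [h] at h1) _ ?_
      rw [smul_sub]
      rw [← neg_eq_zero, ← h5]
      simp
      abel
    · simp at h

theorem lastL_spec {z : Trie} (hz : z.All (fun x => T (dec x.1) = 0)) (l : Bool) (p : PolyW) (hp : NZ p) :
    ev T (lastL z l.toNat p) [] = ev T p [l] := by
  induction p with
  | nil => rfl
  | cons x p ih =>
    obtain ⟨c, b⟩ := x
    simp only [NZ, List.forall_mem_cons] at hp
    have hb := dec_bit b l hp.1
    simp only [lastL]
    split
    · rw [ev_cons, ev_cons, ih hp.2, hb]; simp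
    · rename_i hq
      have := hz.find hq
      simp only [hb] at this
      rw [ev_cons, ih hp.2, this]; simp

theorem tnf_spec {t z : Trie} (ht : t.All (Valid T)) (hz : z.All (fun x => T (dec x.1) = 0)) (v : List Bool) (l : Bool) :
    ev T (tnf t z v l) [] = T (v ++ [l]) := by
  obtain ⟨h1, h2⟩ := mulWd_spec ht v _ NZ_one
  rw [tnf, lastL_spec hz l _ h1, h2 _ (by simp), ev_cons, ev_nil, dec_one]
  simp

theorem tcertP_spec {t z : Trie} (ht : t.All (Valid T)) (hz : z.All (fun x => T (dec x.1) = 0))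
    (hcyc : ∀ u v, T (u ++ v) = T (v ++ u)) (G : List ℕ) (hG : ∀ g ∈ G, wd g ≠ [] ∧ T (wd g) = 0)
    (r : List (ℤ × ℕ × ℕ)) (p : PolyW) (hr : tcertP G t z r = some p) : ev T p [] = 0 := by
  have hl : ∀ w : List Bool, w ≠ [] → w.dropLast ++ [w.getLastD false] = w := by
    intro w hw
    have := List.dropLast_append_getLast hw
    conv_rhs => rw [← this]
    rw [List.getLastD_eq_getLast?, List.getLast?_eq_some_getLast hw]
    rfl
  induction r generalizing p with
  | nil =>
    simp only [tcertP, Option.some.injEq] at hr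
    rw [← hr]; rfl
  | cons x r ih =>
    obtain ⟨k, j, c⟩ := x
    simp only [tcertP] at hr
    split at hr
    · simp at hr
    · rename_i p' hp'
      have hp := ih _ hp'
      split at hr
      · split at hr
        · rename_i hc
          have hc' := hG c (by simpa using hc)
          simp only [Option.some.injEq] at hr
          rw [← hr, ev_smulApp, tnf_spec ht hz, hp, hl _ hc'.1, hc'.2]; simp
        · simp at hr
      · simp only [Option.some.injEq] at hr
        rw [← hr, ev_smulApp, ev_smulApp, tnf_spec ht hz, tnf_spec ht hz, hp, hl _ (by simp), hcyc]
        simp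

include K in
theorem tbuild_spec {t : Trie} (ht : t.All (Valid T))
    (hcyc : ∀ u v, T (u ++ v) = T (v ++ u)) (G : List ℕ) (hG : ∀ g ∈ G, wd g ≠ [] ∧ T (wd g) = 0)
    (R : List TRuleE) (z z' : Trie) (hz : z.All (fun x => T (dec x.1) = 0))
    (h : tbuild G t R z = some z') : z'.All (fun x => T (dec x.1) = 0) := by
  induction R generalizing z with
  | nil => simp only [tbuild, Option.some.injEq] at h; rwa [← h]
  | cons r R ih =>
    simp only [tbuild] at h
    split at h
    · simp at h
    · rename_i p hp
      split at h
      · rename_i hr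
        simp only [Bool.and_eq_true, Bool.not_eq_true'] at hr
        refine ih _ (Trie.All.ins ?_ _ hz _) h
        have h5 := ev_isZ T _ hr.2 []
        rw [ev_collect, ev_nil, ev_cons, tcertP_spec ht hz hcyc G hG _ _ hp] at h5
        refine tors K r.2.1 (fun h => by simp [h] at hr) _ ?_
        rw [← neg_eq_zero, ← h5]
        simp
      · simp at h

theorem allZ_spec {z : Trie} (hz : z.All (fun x => T (dec x.1) = 0)) (l : Bool) (p : PolyW) (hp : NZ p)
    (h : allZ z l.toNat p = true) : ev T p [l] = 0 := by
  induction p with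
  | nil => rfl
  | cons x p ih =>
    obtain ⟨c, b⟩ := x
    simp only [NZ, List.forall_mem_cons] at hp
    simp only [allZ, Bool.and_eq_true] at h
    obtain ⟨q, hq⟩ := Option.isSome_iff_exists.1 h.1
    have := hz.find hq
    simp only [dec_bit b l hp.1] at this
    rw [ev_cons, ih hp.2 h.2, this]; simp

theorem fin_spec {t z : Trie} (ht : t.All (Valid T)) (hz : z.All (fun x => T (dec x.1) = 0)) (k : ℕ) (p : PolyW) (hp : NZ p)
    (h : fin t z k p = true) (e : List Bool) (he : e ≠ []) : ev T p e = 0 := by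
  induction k generalizing p e with
  | zero =>
    simp only [fin, List.isEmpty_iff] at h
    rw [h]; rfl
  | succ k ih =>
    simp only [fin, Bool.or_eq_true, Bool.and_eq_true, List.isEmpty_iff] at h
    rcases h with h | ⟨⟨⟨h1, h2⟩, h3⟩, h4⟩
    · rw [h]; rfl
    · cases e with
      | nil => exact absurd rfl he
      | cons l e =>
        by_cases he' : e = []
        · subst he'
          cases l
          · exact allZ_spec hz false p hp h1
          · exact allZ_spec hz true p hp h2
        · obtain ⟨m1, m2⟩ := mulL_spec ht l p hp
          rw [← m2 e he']
          refine ih _ m1 ?_ e he'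
          cases l
          · exact h3
          · exact h4

include K in
theorem fullCheck_spec (hcyc : ∀ u v, T (u ++ v) = T (v ++ u))
    (hq : ∀ a b c d e : List Bool, a ≠ [] → b ≠ [] → c ≠ [] → d ≠ [] →
    e ≠ [] → q4 (fun w => T (w ++ e)) [] a b c d = 0) (G : List ℕ) (hG : ∀ g ∈ G, wd g ≠ [] ∧ T (wd g) = 0)
    (R : List RuleE) (Q : List TRuleE) (h : fullCheck G R Q = true) (w : List Bool) (hw : w ≠ []) : T w = 0 := by
  have hq' : ∀ v a b c d e : List Bool, a ≠ [] → b ≠ [] → c ≠ [] → d ≠ [] →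
    e ≠ [] → q4 (fun w => T (w ++ e)) v a b c d = 0 := by
    intro v a b c d e ha hb hc hd he
    rw [← hq a b c d (e ++ v) ha hb hc hd (by simp [he])]
    have : ∀ x, T (v ++ x) = T (x ++ v) := fun x => hcyc _ _
    simp only [q4, q3, q2, List.append_assoc, this, List.nil_append]
  simp only [fullCheck] at h
  split at h
  · simp at h
  · rename_i t ht
    have ht' := build_spec (K := K) hq' R .leaf _ trivial ht
    split at h
    · simp at h
    · rename_i z hz
      have hz' := tbuild_spec (K := K) ht' hcyc G hG Q .leaf _ trivial hz
      have := fin_spec ht' hz' 10 _ NZ_one h w hw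
      rw [ev_cons, ev_nil, dec_one] at this
      simpa using this

end sound2
end Refl
end

section
def genCodes : List ℕ :=
  [2, 3, 4, 5, 7, 8, 9, 11, 15, 16, 17, 19, 23, 31, 21, 73, 118, 35, 60, 77, 114, 141, 167, 281, 359, 285, 482,
  549, 617, 723, 695, 1139]

set_option maxHeartbeats 4000000 in
def nilRules : List RuleE :=
  [(16, 24, [], [(1, 1, 2, 2, 2, 2)]), (24, 6, [(-1, 17), (-1, 18), (-1, 20)], [(1, 1, 2, 2, 2, 3)]),
  (28, 4, [(-1, 19), (-1, 21), (-1, 22), (-1, 25), (-1, 26)], [(1, 1, 2, 2, 3, 3)]),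
  (30, 6, [(-1, 23), (-1, 27), (-1, 29)], [(1, 1, 2, 3, 3, 3)]), (31, 24, [], [(1, 1, 3, 3, 3, 3)]),
  (40, 24, [(-1, 34), (-1, 36)], [(-1, 3, 2, 2, 2, 2)]),
  (44, 6, [(-1, 35), (-1, 37), (-1, 41), (-1, 38), (-1, 42)], [(-1, 3, 2, 2, 2, 3)]),
  (52, 6, [(1, 35), (-1, 42), (-1, 50)], [(-1, 1, 2, 2, 2, 7)]),
  (46, 6, [(-1, 39), (-1, 43), (-1, 45)], [(1, 2, 2, 3, 3, 3)]),
  (58, 6, [(-1, 53), (1, 39), (-1, 54)], [(-1, 1, 4, 3, 3, 3), (-1, 2, 2, 3, 3, 3)]),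
  (47, 24, [], [(1, 2, 3, 3, 3, 3)]), (72, 24, [(-1, 68)], [(-1, 5, 2, 2, 2, 2)]),
  (76, 6, [(-1, 69), (-1, 73), (-1, 70), (-1, 74)], [(-1, 5, 2, 2, 2, 3)]),
  (84, 24, [(-1, 74), (-1, 82)], [(1, 7, 2, 2, 2, 2)]),
  (100, 6, [(1, 69), (1, 74), (1, 70)], [(-1, 1, 2, 2, 2, 13)]),
  (78, 6, [(-1, 75), (-1, 77), (-1, 71)], [(-1, 2, 4, 3, 3, 3), (-1, 1, 8, 3, 3, 3), (1, 1, 2, 2, 2, 15)]),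
  (90, 6, [(-1, 85), (-1, 86), (1, 71)], [(1, 1, 8, 3, 3, 3), (-1, 1, 2, 2, 2, 15)]),
  (106, 6, [(-1, 71)], [(1, 1, 2, 2, 2, 15)]),
  (108, 6, [(1, 71), (1, 75), (1, 83), (-1, 102), (1, 85)], [(1, 3, 2, 2, 2, 7), (-1, 1, 8, 3, 3, 3)]),
  (79, 24, [], [(1, 4, 3, 3, 3, 3)]), (110, 6, [(-1, 103), (-1, 107), (-1, 109)], [(1, 6, 2, 3, 3, 3)]),
  (118, 24, [(1, 87), (1, 103), (1, 107)], [(-4, 1, 10, 3, 3, 3), (1, 4, 3, 3, 3, 3), (-4, 6, 2, 3, 3, 3)]),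
  (111, 24, [], [(1, 6, 3, 3, 3, 3)]), (136, 24, [], [(-1, 9, 2, 2, 2, 2)]),
  (140, 24, [(-1, 137), (-1, 138)], [(4, 1, 2, 2, 2, 25), (-1, 13, 2, 2, 2, 2), (-1, 11, 2, 2, 2, 2)]),
  (148, 24, [(-1, 138), (-1, 146)], [(1, 11, 2, 2, 2, 2)]), (164, 24, [(1, 138)], [(1, 13, 2, 2, 2, 2)]),
  (142, 24, [(-1, 141), (-1, 139)], [(4, 1, 2, 2, 2, 29), (4, 1, 2, 2, 2, 27), (-1, 15, 2, 2, 2, 2)]),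
  (154, 24, [(-1, 149), (-1, 150)], [(4, 2, 8, 3, 3, 3), (1, 15, 2, 2, 2, 2)]),
  (170, 24, [], [(-1, 15, 2, 2, 2, 2)]),
  (172, 6, [(1, 139), (1, 147), (-1, 166), (1, 149)], [(1, 5, 2, 2, 2, 7), (-1, 2, 8, 3, 3, 3)]),
  (202, 6, [(-1, 149), (1, 165), (-3, 139), (-1, 150), (-1, 147), (1, 166)], [(1, 3, 2, 2, 2, 13), (2, 1, 2, 2, 2, 27), (1, 1, 2, 2, 2, 29), (2, 2, 8, 3, 3, 3), (-1, 5, 2, 2, 2, 7)]),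
  (204, 12, [(1, 139), (2, 150), (1, 147), (1, 149), (-1, 141)], [(2, 5, 2, 2, 2, 7), (-2, 2, 8, 3, 3, 3), (2, 1, 2, 2, 2, 29), (-1, 15, 2, 2, 2, 2)]),
  (143, 24, [], [(1, 8, 3, 3, 3, 3)]), (174, 6, [(-1, 167), (-1, 171), (-1, 173)], [(1, 10, 2, 3, 3, 3)]),
  (182, 24, [(1, 151), (1, 167), (1, 171)], [(-4, 2, 10, 3, 3, 3), (1, 8, 3, 3, 3, 3), (-4, 10, 2, 3, 3, 3)]),
  (206, 24, [(-1, 203), (-1, 205), (1, 151), (1, 167)], [(-4, 6, 4, 3, 3, 3), (-4, 1, 20, 3, 3, 3), (-4, 1, 18, 3, 3, 3), (3, 8, 3, 3, 3, 3), (-4, 2, 10, 3, 3, 3), (-4, 10, 2, 3, 3, 3)]),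
  (214, 12, [(-3, 151), (-1, 203), (-1, 155), (-1, 171), (1, 205), (1, 173)], [(2, 1, 18, 3, 3, 3), (-1, 8, 3, 3, 3, 3), (2, 2, 10, 3, 3, 3)]),
  (218, 6, [(1, 171), (1, 203), (2, 151), (1, 155), (-1, 205), (-1, 167), (-1, 173)], [(1, 1, 20, 3, 3, 3), (1, 10, 2, 3, 3, 3)]),
  (175, 24, [], [(1, 10, 3, 3, 3, 3)]), (207, 24, [], [(1, 12, 3, 3, 3, 3)]),
  (238, 24, [(1, 183), (1, 219), (1, 215)], [(-4, 1, 22, 3, 3, 3), (1, 10, 3, 3, 3, 3), (1, 12, 3, 3, 3, 3)]),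
  (239, 24, [], [(1, 14, 3, 3, 3, 3)]), (276, 24, [(-1, 274)], [(1, 19, 2, 2, 2, 2)]),
  (292, 24, [], [(1, 21, 2, 2, 2, 2)]),
  (278, 96, [(-1, 275), (-1, 277)], [(-12, 9, 2, 2, 2, 7), (4, 1, 2, 2, 2, 51), (-1, 27, 2, 2, 2, 2), (3, 23, 2, 2, 2, 2), (16, 1, 2, 2, 2, 53)]),
  (282, 96, [(1, 275)], [(1, 23, 2, 2, 2, 2), (12, 9, 2, 2, 2, 7), (-4, 1, 2, 2, 2, 51), (1, 27, 2, 2, 2, 2)]),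
  (298, 24, [], [(-1, 23, 2, 2, 2, 2)]),
  (300, 6, [(1, 275), (-1, 294), (1, 277)], [(1, 9, 2, 2, 2, 7), (-1, 1, 2, 2, 2, 53)]),
  (330, 96, [(1, 293), (1, 294)], [(16, 5, 2, 2, 2, 13), (-3, 27, 2, 2, 2, 2), (1, 23, 2, 2, 2, 2), (-4, 9, 2, 2, 2, 7), (-4, 1, 2, 2, 2, 51), (16, 1, 2, 2, 2, 53)]),
  (332, 48, [(-1, 275), (-1, 277)], [(1, 27, 2, 2, 2, 2), (-4, 9, 2, 2, 2, 7), (4, 1, 2, 2, 2, 51), (1, 23, 2, 2, 2, 2), (8, 1, 2, 2, 2, 53)]),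
  (279, 24, [], [(-1, 2, 20, 3, 3, 3), (1, 1, 36, 3, 3, 3), (-1, 1, 2, 2, 2, 55), (-1, 1, 2, 2, 2, 59), (2, 1, 34, 3, 3, 3), (1, 2, 18, 3, 3, 3)]),
  (302, 6, [(-1, 295), (-1, 299), (-1, 301)], [(1, 18, 2, 3, 3, 3)]),
  (310, 24, [(1, 295), (1, 299)], [(1, 2, 18, 3, 3, 3), (-2, 1, 34, 3, 3, 3), (3, 2, 20, 3, 3, 3), (-3, 1, 36, 3, 3, 3), (3, 1, 2, 2, 2, 55), (3, 1, 2, 2, 2, 59), (-4, 18, 2, 3, 3, 3)]),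
  (333, 24, [(2, 299), (1, 331), (1, 301)], [(-2, 3, 2, 2, 2, 27), (-3, 1, 2, 2, 2, 55), (-2, 1, 2, 2, 2, 59), (5, 1, 36, 3, 3, 3), (6, 1, 34, 3, 3, 3), (1, 10, 4, 3, 3, 3), (1, 2, 18, 3, 3, 3)]),
  (334, 24, [(-2, 331), (-2, 299), (-1, 301), (1, 295)], [(-5, 10, 4, 3, 3, 3), (-8, 1, 36, 3, 3, 3), (6, 1, 2, 2, 2, 55), (5, 1, 2, 2, 2, 59), (2, 3, 2, 2, 2, 27), (-8, 1, 34, 3, 3, 3), (-4, 2, 18, 3, 3, 3), (-1, 2, 20, 3, 3, 3), (-4, 18, 2, 3, 3, 3)]),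
  (342, 24, [(-1, 283), (1, 299), (2, 301)], [(4, 1, 34, 3, 3, 3), (-1, 2, 20, 3, 3, 3), (6, 1, 36, 3, 3, 3), (-4, 1, 2, 2, 2, 55), (-3, 1, 2, 2, 2, 59), (2, 2, 18, 3, 3, 3), (-2, 3, 2, 2, 2, 27), (1, 10, 4, 3, 3, 3)]),
  (346, 24, [(-1, 299), (-2, 301), (-1, 295), (1, 283)], [(-3, 1, 36, 3, 3, 3), (1, 1, 2, 2, 2, 55), (2, 2, 20, 3, 3, 3), (-2, 1, 34, 3, 3, 3), (1, 2, 18, 3, 3, 3), (4, 18, 2, 3, 3, 3), (2, 3, 2, 2, 2, 27), (-1, 10, 4, 3, 3, 3)]),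
  (406, 24, [(1, 283), (1, 295), (-1, 299), (-1, 301), (-1, 331)], [(2, 1, 2, 2, 2, 59), (-4, 18, 2, 3, 3, 3), (-3, 10, 4, 3, 3, 3), (-7, 1, 36, 3, 3, 3), (5, 1, 2, 2, 2, 55), (2, 3, 2, 2, 2, 27), (-6, 1, 34, 3, 3, 3), (-3, 2, 18, 3, 3, 3)]),
  (410, 24, [(1, 301), (-1, 331), (-1, 283)], [(3, 1, 2, 2, 2, 55), (1, 2, 20, 3, 3, 3), (1, 1, 36, 3, 3, 3), (1, 1, 2, 2, 2, 59), (-2, 1, 34, 3, 3, 3), (1, 2, 18, 3, 3, 3), (-2, 10, 4, 3, 3, 3)]),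
  (303, 24, [], [(1, 18, 3, 3, 3, 3)]), (335, 24, [], [(1, 20, 3, 3, 3, 3)]),
  (366, 24, [(1, 311), (1, 347), (1, 343)], [(-4, 2, 22, 3, 3, 3), (1, 18, 3, 3, 3, 3), (1, 20, 3, 3, 3, 3)]),
  (407, 96, [(-1, 343), (-1, 311)], [(4, 6, 10, 3, 3, 3), (4, 1, 42, 3, 3, 3), (4, 1, 38, 3, 3, 3), (-5, 18, 3, 3, 3, 3), (4, 2, 22, 3, 3, 3)]),
  (430, 48, [(-1, 311), (-1, 411), (-1, 347)], [(4, 1, 38, 3, 3, 3), (1, 18, 3, 3, 3, 3), (-4, 6, 10, 3, 3, 3), (-4, 1, 42, 3, 3, 3), (4, 2, 22, 3, 3, 3)]),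
  (438, 24, [(-1, 343)], [(4, 1, 42, 3, 3, 3), (-1, 18, 3, 3, 3, 3), (-1, 20, 3, 3, 3, 3)]),
  (367, 24, [], [(1, 22, 3, 3, 3, 3)]), (431, 24, [], [(1, 26, 3, 3, 3, 3)]),
  (548, 24, [], [(1, 37, 2, 2, 2, 2)]),
  (550, 96, [(-1, 549)], [(-12, 9, 2, 2, 2, 13), (1, 43, 2, 2, 2, 2), (4, 1, 2, 2, 2, 101), (4, 39, 2, 2, 2, 2)]),
  (554, 24, [], [(-1, 39, 2, 2, 2, 2)]),
  (586, 96, [], [(4, 1, 2, 2, 2, 101), (-3, 43, 2, 2, 2, 2), (4, 9, 2, 2, 2, 13)]),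
  (588, 24, [], [(1, 43, 2, 2, 2, 2)]),
  (551, 96, [], [(12, 2, 34, 3, 3, 3), (12, 1, 68, 3, 3, 3), (4, 1, 2, 2, 2, 103), (-1, 55, 2, 2, 2, 2), (12, 1, 2, 2, 2, 107)]),
  (566, 96, [(1, 555)], [(-4, 1, 2, 2, 2, 107), (-12, 1, 2, 2, 2, 103), (3, 55, 2, 2, 2, 2), (12, 2, 34, 3, 3, 3), (12, 1, 68, 3, 3, 3)]),
  (589, 48, [(1, 555), (1, 587)], [(-4, 5, 2, 2, 2, 27), (-1, 55, 2, 2, 2, 2), (6, 1, 2, 2, 2, 103), (4, 1, 68, 3, 3, 3), (2, 18, 4, 3, 3, 3), (12, 1, 2, 2, 2, 107), (14, 2, 34, 3, 3, 3)]),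
  (590, 96, [(-2, 587), (-1, 555)], [(-20, 18, 4, 3, 3, 3), (-8, 1, 2, 2, 2, 103), (1, 55, 2, 2, 2, 2), (8, 5, 2, 2, 2, 27), (-12, 1, 68, 3, 3, 3), (-28, 1, 2, 2, 2, 107), (-32, 2, 34, 3, 3, 3)]),
  (598, 96, [(-1, 555)], [(-4, 1, 68, 3, 3, 3), (8, 1, 2, 2, 2, 103), (-1, 55, 2, 2, 2, 2), (12, 1, 2, 2, 2, 107), (-8, 5, 2, 2, 2, 27), (4, 18, 4, 3, 3, 3)]),
  (602, 48, [(1, 555)], [(-6, 1, 2, 2, 2, 103), (1, 55, 2, 2, 2, 2), (2, 2, 34, 3, 3, 3), (4, 1, 68, 3, 3, 3), (-4, 1, 2, 2, 2, 107), (4, 5, 2, 2, 2, 27), (-2, 18, 4, 3, 3, 3)]),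
  (662, 96, [(-1, 587)], [(-1, 55, 2, 2, 2, 2), (-12, 18, 4, 3, 3, 3), (-8, 1, 2, 2, 2, 103), (8, 5, 2, 2, 2, 27), (-4, 1, 68, 3, 3, 3), (-20, 1, 2, 2, 2, 107), (-16, 2, 34, 3, 3, 3)]),
  (567, 24, [], [(1, 2, 42, 3, 3, 3), (-1, 1, 74, 3, 3, 3), (-1, 1, 2, 2, 2, 119), (1, 1, 70, 3, 3, 3), (2, 2, 38, 3, 3, 3)]),
  (591, 24, [], [(1, 36, 3, 3, 3, 3)]),
  (622, 24, [(1, 599), (1, 603)], [(-2, 2, 38, 3, 3, 3), (1, 1, 70, 3, 3, 3), (-3, 2, 42, 3, 3, 3), (3, 1, 74, 3, 3, 3), (3, 1, 2, 2, 2, 119), (1, 36, 3, 3, 3, 3)]),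
  (663, 24, [(-1, 599)], [(1, 10, 10, 3, 3, 3), (1, 2, 42, 3, 3, 3), (-1, 1, 70, 3, 3, 3)]),
  (686, 24, [(-2, 603), (-1, 599)], [(-2, 2, 42, 3, 3, 3), (-1, 1, 74, 3, 3, 3), (-1, 1, 2, 2, 2, 119), (2, 2, 38, 3, 3, 3), (-3, 10, 10, 3, 3, 3)]),
  (694, 24, [(-1, 599)], [(4, 2, 42, 3, 3, 3), (-1, 36, 3, 3, 3, 3)]),
  (822, 24, [], [(-3, 2, 42, 3, 3, 3), (4, 1, 74, 3, 3, 3), (3, 1, 70, 3, 3, 3), (1, 36, 3, 3, 3, 3), (-3, 10, 10, 3, 3, 3)]),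
  (623, 24, [], [(1, 38, 3, 3, 3, 3)]), (687, 24, [], [(1, 42, 3, 3, 3, 3)]),
  (823, 96, [(-1, 695)], [(4, 6, 22, 3, 3, 3), (4, 1, 86, 3, 3, 3), (-1, 38, 3, 3, 3, 3)]),
  (878, 48, [(-1, 695)], [(4, 1, 86, 3, 3, 3), (-4, 6, 22, 3, 3, 3), (-1, 38, 3, 3, 3, 3), (-2, 42, 3, 3, 3, 3)]),
  (879, 24, [], [(1, 54, 3, 3, 3, 3)]), (1098, 24, [], [(-1, 75, 2, 2, 2, 2)]),
  (1099, 96, [], [(4, 9, 2, 2, 2, 27), (-3, 87, 2, 2, 2, 2), (20, 1, 2, 2, 2, 203)]),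
  (1110, 48, [], [(-4, 1, 2, 2, 2, 203), (1, 87, 2, 2, 2, 2), (-4, 9, 2, 2, 2, 27)]),
  (1174, 96, [], [(-3, 87, 2, 2, 2, 2), (4, 1, 2, 2, 2, 203), (4, 9, 2, 2, 2, 27)]),
  (1111, 24, [], [(-3, 2, 70, 3, 3, 3), (3, 1, 138, 3, 3, 3), (-2, 1, 2, 2, 2, 215)]),
  (1175, 24, [], [(1, 18, 10, 3, 3, 3), (1, 1, 2, 2, 2, 215), (-2, 1, 138, 3, 3, 3), (1, 2, 70, 3, 3, 3)]),
  (1198, 24, [], [(1, 1, 2, 2, 2, 215), (-3, 18, 10, 3, 3, 3), (-1, 2, 70, 3, 3, 3)]),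
  (1206, 24, [], [(-2, 1, 2, 2, 2, 215), (-1, 2, 70, 3, 3, 3), (1, 1, 138, 3, 3, 3)]),
  (1199, 24, [], [(1, 74, 3, 3, 3, 3)]),
  (1207, 96, [], [(4, 2, 86, 3, 3, 3), (4, 1, 150, 3, 3, 3), (-3, 74, 3, 3, 3, 3)]),
  (1390, 96, [], [(-20, 1, 150, 3, 3, 3), (-4, 2, 86, 3, 3, 3), (3, 74, 3, 3, 3, 3)]),
  (1391, 24, [], [(1, 86, 3, 3, 3, 3)])]

set_option maxHeartbeats 4000000 in
def trRules : List TRuleE :=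
  [(2, 1, [(1, 2, 2)]), (3, 1, [(1, 2, 3)]), (4, 1, [(1, 2, 4)]), (5, 1, [(1, 2, 5)]), (6, 1, [(-1, 1, 2)]),
  (7, 1, [(1, 2, 7)]), (8, 1, [(1, 2, 8)]), (9, 1, [(1, 2, 9)]), (12, 1, [(-1, 1, 4)]), (10, 1, [(1, 0, 5)]),
  (11, 1, [(1, 2, 11)]), (13, 1, [(-1, 1, 5)]), (14, 1, [(-1, 1, 6)]), (15, 1, [(1, 2, 15)]),
  (16, 1, [(1, 2, 16)]), (17, 1, [(1, 2, 17)]), (24, 1, [(-1, 1, 8)]), (18, 1, [(1, 0, 9)]),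
  (20, 1, [(1, 0, 10)]), (19, 1, [(1, 2, 19)]), (21, 1, [(1, 2, 21)]), (25, 1, [(-1, 1, 9)]),
  (26, 1, [(-1, 1, 10)]), (22, 1, [(1, 0, 11)]), (28, 1, [(-1, 1, 12)]), (23, 1, [(1, 2, 23)]),
  (27, 1, [(-1, 1, 11)]), (29, 1, [(-1, 1, 13)]), (30, 1, [(-1, 1, 14)]), (31, 1, [(1, 2, 31)]),
  (34, 1, [(1, 0, 17)]), (36, 1, [(1, 0, 18)]), (40, 1, [(1, 0, 20)]), (35, 1, [(1, 2, 35)]),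
  (38, 1, [(1, 0, 19)]), (44, 1, [(1, 0, 22)]), (37, 2, [(1, 0, 25), (1, 1, 18), (1, 1, 17)]),
  (41, 1, [(1, 1, 17)]), (50, 1, [(-1, 1, 18)]), (52, 1, [(-1, 1, 20)]), (42, 1, [(1, 0, 21)]),
  (46, 1, [(-1, 0, 30), (1, 2, 60)]), (39, 1, [(-1, 0, 23)]), (51, 1, [(-1, 1, 19)]),
  (43, 2, [(-1, 0, 27), (-1, 2, 60), (1, 1, 26), (1, 1, 21)]), (53, 1, [(-1, 1, 21)]), (45, 1, [(1, 1, 25)]),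
  (58, 1, [(-1, 1, 26)]), (54, 1, [(1, 0, 27)]), (47, 1, [(-1, 0, 31)]), (55, 1, [(-1, 1, 23)]),
  (59, 1, [(-1, 1, 27)]), (68, 1, [(1, 0, 34)]), (72, 1, [(1, 0, 36)]), (73, 1, [(1, 2, 73)]),
  (70, 1, [(1, 0, 35)]), (100, 1, [(-1, 1, 36)]), (76, 1, [(1, 0, 38)]), (82, 1, [(1, 0, 41)]),
  (84, 2, [(-1, 0, 52)]), (74, 2, [(1, 0, 56)]), (69, 1, [(1, 1, 34)]), (77, 1, [(1, 2, 77)]),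
  (102, 1, [(-1, 1, 38)]), (90, 1, [(1, 0, 45)]), (83, 1, [(-1, 0, 51)]),
  (71, 2, [(-1, 1, 41), (1, 1, 42), (-1, 1, 37), (-1, 2, 114), (-1, 0, 39), (-1, 0, 43)]), (75, 1, [(1, 1, 35)]),
  (101, 1, [(-1, 1, 37)]), (78, 1, [(1, 0, 39)]), (85, 1, [(1, 1, 41)]), (106, 1, [(-1, 1, 42)]),
  (86, 1, [(1, 0, 43)]), (108, 1, [(-1, 1, 44)]), (118, 1, [(1, 2, 118)]), (79, 1, [(-1, 0, 47)]),
  (109, 1, [(1, 1, 54)]), (91, 1, [(-1, 0, 59)]), (103, 1, [(-1, 1, 39)]), (107, 2, [(1, 1, 53)]),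
  (87, 2, [(-1, 1, 57)]), (110, 1, [(1, 1, 58)]), (111, 1, [(-1, 1, 47)]), (119, 1, [(-1, 1, 55)]),
  (136, 1, [(1, 0, 68)]), (138, 1, [(1, 0, 69)]), (140, 1, [(1, 0, 70)]), (148, 1, [(1, 0, 74)]),
  (146, 1, [(-1, 0, 76)]), (164, 1, [(-1, 1, 80)]), (137, 1, [(1, 0, 81)]), (141, 1, [(1, 2, 141)]),
  (142, 1, [(1, 0, 71)]), (154, 1, [(1, 0, 77)]), (150, 1, [(-1, 0, 78)]), (172, 1, [(1, 0, 86)]),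
  (170, 1, [(-1, 0, 90)]), (166, 1, [(1, 1, 70)]), (139, 1, [(-1, 0, 75)]), (147, 1, [(-1, 0, 83)]),
  (149, 1, [(-1, 0, 85)]), (204, 1, [(1, 1, 88)]), (165, 1, [(-1, 1, 98)]), (202, 1, [(1, 0, 101)]),
  (167, 1, [(1, 2, 167)]), (143, 1, [(-1, 0, 79)]), (171, 1, [(1, 1, 85)]), (151, 2, [(-1, 1, 99)]),
  (206, 1, [(1, 0, 103)]), (214, 1, [(1, 0, 107)]), (203, 1, [(-1, 1, 75)]), (155, 1, [(-1, 1, 78)]),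
  (173, 1, [(1, 1, 86)]), (174, 1, [(1, 0, 87)]), (205, 1, [(1, 1, 89)]), (218, 1, [(-1, 1, 90)]),
  (182, 1, [(1, 0, 91)]), (207, 1, [(-1, 1, 79)]), (175, 1, [(-1, 0, 111)]), (219, 1, [(1, 1, 122)]),
  (215, 1, [(-1, 1, 87)]), (183, 1, [(1, 1, 91)]), (238, 1, [(-1, 1, 110)]), (239, 1, [(-1, 1, 111)]),
  (274, 1, [(1, 0, 137)]), (276, 1, [(1, 0, 138)]), (292, 1, [(1, 1, 144)]), (278, 1, [(1, 0, 139)]),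
  (282, 1, [(1, 0, 141)]), (300, 1, [(1, 0, 150)]), (298, 1, [(-1, 0, 154)]), (293, 1, [(1, 1, 168)]),
  (277, 1, [(-1, 0, 201)]), (330, 1, [(1, 0, 209)]), (275, 1, [(-1, 2, 281)]), (332, 1, [(1, 1, 140)]),
  (294, 1, [(1, 0, 147)]), (342, 1, [(-1, 2, 482)]), (299, 1, [(-1, 0, 171)]),
  (331, 1, [(1, 1, 139), (1, 2, 285)]), (295, 1, [(-1, 1, 163)]), (334, 1, [(1, 0, 167)]),
  (406, 1, [(1, 0, 203)]), (301, 1, [(1, 1, 150)]), (279, 2, [(-1, 1, 153)]), (410, 1, [(-1, 1, 154)]),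
  (333, 1, [(1, 1, 166)]), (283, 1, [(-1, 1, 169)]), (346, 1, [(1, 0, 173)]), (302, 1, [(-1, 0, 174)]),
  (310, 1, [(-1, 0, 179)]), (343, 1, [(1, 1, 171)]), (303, 1, [(-1, 0, 175)]), (335, 2, [(-1, 1, 199)]),
  (430, 1, [(1, 0, 215)]), (438, 1, [(-1, 1, 234)]), (347, 1, [(1, 0, 235)]), (311, 1, [(-1, 2, 359)]),
  (407, 1, [(-1, 1, 151)]), (411, 1, [(-1, 1, 155)]), (366, 1, [(1, 0, 183)]), (431, 1, [(-1, 1, 175)]),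
  (367, 1, [(1, 1, 207)]), (439, 1, [(1, 1, 215)]), (548, 1, [(1, 0, 274)]), (549, 1, [(1, 2, 549)]),
  (550, 1, [(1, 0, 275)]), (554, 1, [(1, 0, 277)]), (588, 1, [(-1, 1, 280)]), (586, 1, [(1, 1, 290)]),
  (566, 1, [(1, 0, 283)]), (602, 1, [(1, 0, 314)]), (551, 1, [(-1, 2, 617), (1, 0, 299), (1, 1, 294)]),
  (589, 1, [(-1, 1, 281)]), (598, 1, [(-1, 1, 294)]), (590, 1, [(1, 0, 295)]), (662, 2, [(-1, 1, 298)]),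
  (555, 1, [(-1, 0, 299)]), (587, 2, [(-1, 1, 325)]), (591, 1, [(-1, 0, 335)]), (663, 1, [(-1, 1, 355)]),
  (567, 2, [(-2, 2, 723), (1, 1, 283)]), (599, 1, [(1, 1, 279)]), (603, 2, [(1, 1, 283)]),
  (822, 1, [(-1, 1, 310)]), (622, 1, [(1, 0, 311)]), (686, 1, [(-1, 1, 314)]), (694, 1, [(-1, 1, 346)]),
  (695, 1, [(1, 2, 695)]), (623, 1, [(-1, 1, 335)]), (687, 1, [(1, 1, 343)]), (823, 1, [(-1, 1, 347)]),
  (878, 1, [(-1, 1, 366)]), (879, 1, [(-1, 1, 367)]), (1098, 1, [(1, 1, 548)]), (1099, 2, [(1, 1, 549)]),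
  (1110, 1, [(1, 0, 555)]), (1174, 1, [(-1, 1, 556)]), (1111, 1, [(1, 2, 1139)]), (1175, 1, [(-1, 1, 551)]),
  (1198, 1, [(-1, 1, 590)]), (1206, 1, [(1, 1, 602)]), (1199, 1, [(-1, 1, 591)]), (1207, 2, [(1, 1, 603)]),
  (1390, 1, [(1, 1, 622)]), (1391, 1, [(1, 1, 623)])]

set_option maxRecDepth 100000 in
theorem fullCheck_ok : fullCheck genCodes nilRules trRules = true := by decide +kernel

theorem gen_wd (i : Fin 32) (K : Type*) [Field K] : gens32' K i = trw K (wd (genCodes.get i)) := by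
  fin_cases i <;> simp [gens32', genCodes, wd, dcd, trw, mat, pow_succ, mul_assoc]
end

section
theorem genCodes_ne : ∀ g ∈ genCodes, wd g ≠ [] := by decide +kernel

theorem gen_wd' (K : Type*) [Field K] (g : ℕ) (hg : g ∈ genCodes) : trw K (wd g) ∈ Set.range (gens32' K) := by
  obtain ⟨i, rfl⟩ := List.mem_iff_get.1 hg
  exact ⟨i, gen_wd i K⟩

theorem generation (K : Type*) [Field K] [CharZero K] :
    Algebra.adjoin K (Set.range (gens32' K)) = pureAlg K 4 := by
  apply le_antisymm
  · refine Algebra.adjoin_le ?_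
    rintro _ ⟨i, rfl⟩
    rw [gen_wd]
    exact trw_mem_pure K _
  · refine fft K _ fun w => ?_
    refine gen_of_abstract K _ (genCodes.map wd) ?_ ?_ w
    · intro g hg
      obtain ⟨c, hc, rfl⟩ := List.mem_map.1 hg
      exact Algebra.subset_adjoin (gen_wd' K c hc)
    · intro t h1 h2 h3 w hw
      exact fullCheck_spec (K := K) h1 h2 genCodes (fun g hg => ⟨genCodes_ne g hg, h3 _ (List.mem_map_of_mem hg)⟩)
        nilRules trRules fullCheck_ok w hw
end

section
noncomputable section
section Sft
open Equiv

def DS {m : ℕ} (ρ : Perm (Fin m)) : ℕ → Fin m → Prop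
  | 0, _ => True
  | n + 1, i => ∃ j, j < i ∧ ρ i < ρ j ∧ DS ρ n j

theorem DS_mono {m : ℕ} (ρ : Perm (Fin m)) (n : ℕ) (i : Fin m) (h : DS ρ (n + 1) i) : DS ρ n i := by
  induction n generalizing i with
  | zero => trivial
  | succ n ih =>
    obtain ⟨j, h1, h2, h3⟩ := h
    exact ⟨j, h1, h2, ih j h3⟩

theorem exists_coloring {m : ℕ} (ρ : Perm (Fin m)) (h : ∀ i, ¬ DS ρ 4 i) :
    ∃ c : Fin m → Fin 4, ∀ i j, i < j → c i = c j → ρ i < ρ j := by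
  classical
  have hd : ∀ i, DS ρ (Nat.findGreatest (fun n => DS ρ n i) 3) i := fun i =>
    Nat.findGreatest_spec (P := fun n => DS ρ n i) (Nat.zero_le 3) trivial
  refine ⟨fun i => ⟨Nat.findGreatest (fun n => DS ρ n i) 3, Nat.lt_succ_of_le (Nat.findGreatest_le 3)⟩, fun i j hij hc => ?_⟩
  by_contra hlt
  have h1 : ρ j < ρ i := lt_of_le_of_ne (not_lt.1 hlt) fun h => hij.ne' (ρ.injective h)
  have h2 : DS ρ (Nat.findGreatest (fun n => DS ρ n i) 3 + 1) j := ⟨i, hij, h1, hd i⟩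
  have h3 : Nat.findGreatest (fun n => DS ρ n i) 3 + 1 ≤ 3 := by
    by_contra h4
    have : Nat.findGreatest (fun n => DS ρ n i) 3 = 3 := le_antisymm (Nat.findGreatest_le 3) (by omega)
    rw [this] at h2
    exact h j h2
  have h4 := Nat.le_findGreatest (P := fun n => DS ρ n j) h3 h2
  have h5 : Nat.findGreatest (fun n => DS ρ n i) 3 = Nat.findGreatest (fun n => DS ρ n j) 3 := congrArg Fin.val hc
  omega

theorem exists_dec {m : ℕ} (ρ : Perm (Fin m)) (i : Fin m) (h : DS ρ 4 i) :
    ∃ f : Fin 5 → Fin m, StrictMono f ∧ StrictAnti (ρ ∘ f) := by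
  obtain ⟨i3, a3, b3, i2, a2, b2, i1, a1, b1, i0, a0, b0, -⟩ := h
  refine ⟨![i0, i1, i2, i3, i], ?_, ?_⟩
  · rw [Fin.strictMono_iff_lt_succ]
    intro k; fin_cases k <;> simpa
  · rw [Fin.strictAnti_iff_succ_lt]
    intro k; fin_cases k <;> simpa

theorem perm_first {m : ℕ} (π : Perm (Fin m)) (h : π ≠ 1) : ∃ k, (∀ j < k, π j = j) ∧ k < π k := by
  have h1 : ∃ k, π k ≠ k := by
    by_contra h2
    push Not at h2
    exact h (Perm.ext h2)
  obtain ⟨k, hk, hmin⟩ := WellFounded.has_min (wellFounded_lt (α := Fin m)) {k | π k ≠ k} h1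
  have h3 : ∀ j < k, π j = j := fun j hj => by
    by_contra h4
    exact hmin j h4 hj
  refine ⟨k, h3, lt_of_le_of_ne (not_lt.1 fun h4 => ?_) (Ne.symm hk)⟩
  have := h3 _ h4
  exact hk (π.injective this)

variable {K : Type*} [Field K]

/-- antisymmetrizer -/
def asym (K : Type*) [Field K] {m : ℕ} (σ : Perm (Fin m)) (f : Fin 5 ↪ Fin m) : Perm (Fin m) → K :=
  ∑ τ : Perm (Fin 5), (((Perm.sign τ : ℤˣ) : ℤ) : K) • Pi.single (σ * τ.viaFintypeEmbedding f) 1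

theorem straighten (K : Type*) [Field K] {m : ℕ} (σ : Perm (Fin m)) :
    (Pi.single σ 1 : Perm (Fin m) → K) ∈
      Submodule.span K (Set.range fun p : Perm (Fin m) × (Fin 5 ↪ Fin m) => asym K p.1 p.2) ⊔
      Submodule.span K ((fun ρ => Pi.single ρ 1) '' {ρ : Perm (Fin m) | ∀ i, ¬ DS ρ 4 i}) := by
  have wf : WellFounded fun (a b : Perm (Fin m)) => toLex (⇑a) < toLex (⇑b) :=
    InvImage.wf (fun a : Perm (Fin m) => toLex (⇑a)) wellFounded_lt
  induction σ using wf.induction with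
  | _ σ ih =>
  by_cases hg : ∀ i, ¬ DS σ 4 i
  · exact Submodule.mem_sup_right (Submodule.subset_span ⟨σ, hg, rfl⟩)
  · push Not at hg
    obtain ⟨i, hi⟩ := hg
    obtain ⟨f, hf1, hf2⟩ := exists_dec σ i hi
    let F : Fin 5 ↪ Fin m := ⟨f, hf1.injective⟩
    have h1 : asym K σ F = Pi.single σ 1 + ∑ τ ∈ Finset.univ.erase (1 : Perm (Fin 5)),
        (((Perm.sign τ : ℤˣ) : ℤ) : K) • Pi.single (σ * τ.viaFintypeEmbedding F) 1 := by
      rw [asym, ← Finset.add_sum_erase Finset.univ _ (Finset.mem_univ 1)]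
      congr 1
      have : (1 : Perm (Fin 5)).viaFintypeEmbedding F = 1 := by
        simp [Perm.viaFintypeEmbedding]
      rw [this]; simp
    have h2 : (Pi.single σ 1 : Perm (Fin m) → K) = asym K σ F - ∑ τ ∈ Finset.univ.erase (1 : Perm (Fin 5)),
        (((Perm.sign τ : ℤˣ) : ℤ) : K) • Pi.single (σ * τ.viaFintypeEmbedding F) 1 := by
      rw [h1]; simp
    rw [h2]
    refine Submodule.sub_mem _ (Submodule.mem_sup_left (Submodule.subset_span ⟨(σ, F), rfl⟩)) ?_
    refine Submodule.sum_mem _ fun τ hτ => Submodule.smul_mem _ _ (ih _ ?_)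
    obtain ⟨k, hk1, hk2⟩ := perm_first τ (Finset.ne_of_mem_erase hτ)
    refine ⟨f k, fun j hj => ?_, ?_⟩
    · change σ (τ.viaFintypeEmbedding F j) = σ j
      congr 1
      by_cases hjr : j ∈ Set.range F
      · obtain ⟨a, rfl⟩ := hjr
        rw [Perm.viaFintypeEmbedding_apply_image, hk1 a (hf1.lt_iff_lt.1 hj)]
      · exact Perm.viaFintypeEmbedding_apply_notMem_range _ _ hjr
    · change σ (τ.viaFintypeEmbedding F (F k)) < σ (f k)
      rw [Perm.viaFintypeEmbedding_apply_image]
      exact hf2 hk2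

theorem indep_good {m : ℕ} (d : Perm (Fin m) → K) (hd : ∀ ρ, d ρ ≠ 0 → ∀ i, ¬ DS ρ 4 i)
    (h : ∀ I J : Fin m → Fin 4, ∑ σ : Perm (Fin m), (if I ∘ σ = J then d σ else 0) = 0) : d = 0 := by
  classical
  by_contra hne
  have hne' : (Finset.univ.filter fun ρ => d ρ ≠ 0).Nonempty := by
    obtain ⟨ρ, hρ⟩ := Function.ne_iff.1 hne
    exact ⟨ρ, by simpa using hρ⟩
  obtain ⟨ρ, hρ, hmax⟩ := Finset.exists_max_image _ (fun ρ : Perm (Fin m) => toLex (⇑ρ)) hne'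
  simp only [Finset.mem_filter, Finset.mem_univ, true_and] at hρ hmax
  obtain ⟨c, hc⟩ := exists_coloring ρ (hd ρ hρ)
  have := h (c ∘ ρ.symm) c
  rw [Finset.sum_eq_single ρ] at this
  · rw [if_pos (by funext i; simp)] at this
    exact hρ this
  · intro τ _ hτ
    by_cases hτ0 : d τ = 0
    · simp [hτ0]
    rw [if_neg]
    intro heq
    obtain ⟨k, hk1, hk2⟩ := perm_first (ρ⁻¹ * τ) (fun h => hτ (by rw [inv_mul_eq_one] at h; exact h.symm))
    have h1 := hc k _ hk2 (by
      have := congrFun heq k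
      exact this.symm)
    have h2 : ∀ i, ρ ((ρ⁻¹ * τ) i) = τ i := fun i => by simp
    rw [h2] at h1
    refine absurd (hmax τ hτ0) (not_le.2 ⟨k, fun j hj => ?_, h1⟩)
    have := hk1 j hj
    change ρ j = τ j
    rw [← h2, this]
  · simp

theorem asym_eval {m : ℕ} (σ : Perm (Fin m)) (f : Fin 5 ↪ Fin m) (I J : Fin m → Fin 4) :
    ∑ ρ : Perm (Fin m), (if I ∘ ρ = J then asym K σ f ρ else 0) = 0 := by
  have h1 : ∀ ρ, asym K σ f ρ = ∑ τ : Perm (Fin 5), (((Perm.sign τ : ℤˣ) : ℤ) : K) *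
      (if ρ = σ * τ.viaFintypeEmbedding f then 1 else 0) := by
    intro ρ
    simp [asym, Finset.sum_apply, Pi.single_apply]
  have h2 : ∑ ρ : Perm (Fin m), (if I ∘ ρ = J then asym K σ f ρ else 0) =
      ∑ τ : Perm (Fin 5), (((Perm.sign τ : ℤˣ) : ℤ) : K) *
        (if I ∘ (σ * τ.viaFintypeEmbedding f : Perm (Fin m)) = J then 1 else 0) := by
    have h3 : ∀ ρ : Perm (Fin m), (if I ∘ ρ = J then asym K σ f ρ else 0) =
        ∑ τ : Perm (Fin 5), (((Perm.sign τ : ℤˣ) : ℤ) : K) *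
          (if ρ = σ * τ.viaFintypeEmbedding f then (if I ∘ ρ = J then 1 else 0) else 0) := by
      intro ρ
      rw [h1]
      by_cases h : I ∘ ρ = J <;> simp [h]
    rw [Finset.sum_congr rfl fun ρ _ => h3 ρ, Finset.sum_comm]
    refine Finset.sum_congr rfl fun τ _ => ?_
    rw [← Finset.mul_sum, Finset.sum_ite_eq' Finset.univ (σ * τ.viaFintypeEmbedding f)]
    simp
  rw [h2]
  obtain ⟨a, b, hab, hI⟩ := Fintype.exists_ne_map_eq_of_card_lt (I ∘ σ ∘ f) (by simp)
  refine Finset.sum_involution (fun τ _ => swap a b * τ) ?_ ?_ ?_ ?_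
  · intro τ _
    have h3 : I ∘ (σ * (swap a b * τ).viaFintypeEmbedding f : Perm (Fin m)) =
        I ∘ (σ * τ.viaFintypeEmbedding f : Perm (Fin m)) := by
      funext j
      simp only [Function.comp_apply, Perm.mul_apply]
      by_cases hjr : j ∈ Set.range f
      · obtain ⟨k, rfl⟩ := hjr
        rw [Perm.viaFintypeEmbedding_apply_image, Perm.viaFintypeEmbedding_apply_image, Perm.mul_apply]
        by_cases h1 : τ k = a
        · rw [h1, swap_apply_left]; exact hI.symm
        · by_cases h2 : τ k = b
          · rw [h2, swap_apply_right]; exact hI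
          · rw [swap_apply_of_ne_of_ne h1 h2]
      · rw [Perm.viaFintypeEmbedding_apply_notMem_range _ _ hjr, Perm.viaFintypeEmbedding_apply_notMem_range _ _ hjr]
    rw [h3, Perm.sign_mul, Perm.sign_swap hab]
    push_cast
    ring
  · intro τ _ _ h
    have := congrArg (fun g : Perm (Fin 5) => g (τ⁻¹ a)) h
    simp only [Perm.mul_apply, show τ (τ⁻¹ a) = a by simp, Equiv.swap_apply_left] at this
    exact hab this.symm
  · intros; simp
  · intro τ _
    rw [← mul_assoc, Equiv.swap_mul_self, one_mul]

theorem sft {m : ℕ} (c lam : Perm (Fin m) → K)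
    (hc : ∀ I J : Fin m → Fin 4, ∑ σ : Perm (Fin m), (if I ∘ σ = J then c σ else 0) = 0)
    (hl : ∀ (σ : Perm (Fin m)) (f : Fin 5 ↪ Fin m), ∑ τ : Perm (Fin 5),
      (((Perm.sign τ : ℤˣ) : ℤ) : K) * lam (σ * τ.viaFintypeEmbedding f) = 0) :
    ∑ σ, c σ * lam σ = 0 := by
  classical
  let L : (Perm (Fin m) → K) →ₗ[K] K := ∑ σ, (lam σ) • LinearMap.proj σ
  let E : (Fin m → Fin 4) → (Fin m → Fin 4) → (Perm (Fin m) → K) →ₗ[K] K := fun I J =>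
    ∑ σ : Perm (Fin m), (if I ∘ ⇑σ = J then (1 : K) else 0) • LinearMap.proj σ
  have hL : ∀ c, L c = ∑ σ, c σ * lam σ := fun c => by simp [L, mul_comm]
  have hE : ∀ I J c, E I J c = ∑ σ : Perm (Fin m), (if I ∘ ⇑σ = J then c σ else 0) := fun I J c => by
    simp only [E, LinearMap.sum_apply, LinearMap.smul_apply, LinearMap.proj_apply, smul_eq_mul, ite_mul, one_mul, zero_mul]
  have hcm : c ∈ Submodule.span K (Set.range fun p : Perm (Fin m) × (Fin 5 ↪ Fin m) => asym K p.1 p.2) ⊔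
      Submodule.span K ((fun ρ => Pi.single ρ 1) '' {ρ : Perm (Fin m) | ∀ i, ¬ DS ρ 4 i}) := by
    have : c = ∑ σ, c σ • (Pi.single σ 1 : Perm (Fin m) → K) := by
      funext ρ; simp [Finset.sum_apply, Pi.single_apply]
    rw [this]
    exact Submodule.sum_mem _ fun σ _ => Submodule.smul_mem _ _ (straighten K σ)
  obtain ⟨n, hn, d, hd, rfl⟩ := Submodule.mem_sup.1 hcm
  have hEn : ∀ I J, E I J n = 0 := by
    intro I J
    refine (LinearMap.mem_ker).1 ((Submodule.span_le.2 ?_) hn : n ∈ LinearMap.ker (E I J))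
    rintro _ ⟨p, rfl⟩
    simp only [SetLike.mem_coe, LinearMap.mem_ker, hE]
    exact asym_eval _ _ _ _
  have hLn : L n = 0 := by
    refine (LinearMap.mem_ker).1 ((Submodule.span_le.2 ?_) hn : n ∈ LinearMap.ker L)
    rintro _ ⟨p, rfl⟩
    simp only [SetLike.mem_coe, LinearMap.mem_ker]
    rw [← hl p.1 p.2, asym, map_sum]
    refine Finset.sum_congr rfl fun τ _ => ?_
    rw [map_smul, hL, smul_eq_mul]
    simp [Pi.single_apply]
  have hd0 : d = 0 := by
    refine indep_good d ?_ ?_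
    · intro ρ hρ
      by_contra hbad
      apply hρ
      refine (LinearMap.mem_ker).1 ((Submodule.span_le.2 ?_) hd : d ∈ LinearMap.ker (LinearMap.proj (R := K) (φ := fun _ : Perm (Fin m) => K) ρ))
      rintro _ ⟨σ, hσ, rfl⟩
      simp only [SetLike.mem_coe, LinearMap.mem_ker, LinearMap.proj_apply]
      rw [Pi.single_apply, if_neg]
      rintro rfl
      exact hbad hσ
    · intro I J
      have := hc I J
      rw [← hE, map_add, hEn, zero_add, hE] at this
      exact this
  rw [← hL, map_add, hLn, hd0]; simp

end Sft
end
end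

section
noncomputable section
section LamF
open Equiv
variable {K : Type*} [Field K]

theorem formPerm_map_apply {α β : Type*} [DecidableEq α] [DecidableEq β] (g : α → β) (hg : Function.Injective g)
    (L : List α) (a : α) : (L.map g).formPerm (g a) = g (L.formPerm a) := by
  induction L with
  | nil => simp
  | cons x L ih =>
    cases L with
    | nil => simp
    | cons y L =>
      simp only [List.map_cons] at ih ⊢
      rw [List.formPerm_cons_cons, List.formPerm_cons_cons, Perm.mul_apply, Perm.mul_apply, ih, hg.swap_apply]

def FullL {α : Type*} (L : List α) : Prop := L ≠ [] ∧ L.Nodup ∧ ∀ a, a ∈ L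

def lamf (ℓ : List Bool → K) {α : Type*} [DecidableEq α] (σ : Perm α) (z : α → List Bool) : K :=
  open Classical in
  if h : ∃ L : List α, FullL L ∧ L.formPerm = σ then ℓ (h.choose.flatMap z) else 0

theorem rot_eq (ℓ : List Bool → K) (hℓ : ∀ u v, ℓ (u ++ v) = ℓ (v ++ u)) {α : Type*} (z : α → List Bool) {L L' : List α}
    (h : L ~r L') : ℓ (L.flatMap z) = ℓ (L'.flatMap z) := by
  obtain ⟨n, hn, rfl⟩ := List.isRotated_iff_mod.1 h
  rw [List.rotate_eq_drop_append_take hn, List.flatMap_append, hℓ, ← List.flatMap_append, List.take_append_drop]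

theorem lamf_of (ℓ : List Bool → K) (hℓ : ∀ u v, ℓ (u ++ v) = ℓ (v ++ u)) {α : Type*} [DecidableEq α] (σ : Perm α)
    (z : α → List Bool) (L : List α) (hL : FullL L) (hs : L.formPerm = σ) : lamf ℓ σ z = ℓ (L.flatMap z) := by
  have h : ∃ L : List α, FullL L ∧ L.formPerm = σ := ⟨L, hL, hs⟩
  rw [lamf, dif_pos h]
  obtain ⟨h1, h2⟩ := h.choose_spec
  generalize h.choose = L' at h1 h2
  have h3 : L'.formPerm = L.formPerm := by rw [h2, hs]
  rcases (List.formPerm_eq_formPerm_iff h1.2.1 hL.2.1).1 h3 with h4 | ⟨h4, h5⟩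
  · exact rot_eq ℓ hℓ z h4
  · obtain ⟨x, rfl⟩ := List.length_eq_one_iff.1 (le_antisymm h4 (List.length_pos_iff.2 h1.1))
    obtain ⟨y, rfl⟩ := List.length_eq_one_iff.1 (le_antisymm h5 (List.length_pos_iff.2 hL.1))
    have := hL.2.2 x
    simp only [List.mem_singleton] at this
    rw [this]

theorem lamf_zero (ℓ : List Bool → K) {α : Type*} [DecidableEq α] (σ : Perm α)
    (z : α → List Bool) (h : ¬ ∃ L : List α, FullL L ∧ L.formPerm = σ) : lamf ℓ σ z = 0 := by
  rw [lamf, dif_neg h]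

theorem lamf_fix (ℓ : List Bool → K) {α : Type*} [DecidableEq α] [Nontrivial α] (σ : Perm α) (a : α) (ha : σ a = a)
    (z : α → List Bool) : lamf ℓ σ z = 0 := by
  refine lamf_zero _ _ _ ?_
  rintro ⟨L, hL, rfl⟩
  have := (List.formPerm_apply_mem_eq_self_iff L hL.2.1 a (hL.2.2 a)).1 ha
  obtain ⟨x, rfl⟩ := List.length_eq_one_iff.1 (le_antisymm this (List.length_pos_iff.2 hL.1))
  obtain ⟨p, q, hpq⟩ := exists_pair_ne α
  have h1 := hL.2.2 p
  have h2 := hL.2.2 q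
  simp only [List.mem_singleton] at h1 h2
  exact hpq (h1.trans h2.symm)

theorem FullL.map {α β : Type*} (e : α ≃ β) {L : List α} (h : FullL L) : FullL (L.map e) :=
  ⟨by simpa using h.1, h.2.1.map e.injective, fun b => List.mem_map.2 ⟨e.symm b, h.2.2 _, by simp⟩⟩

theorem lamf_conj (ℓ : List Bool → K) (hℓ : ∀ u v, ℓ (u ++ v) = ℓ (v ++ u)) {α β : Type*} [DecidableEq α] [DecidableEq β]
    (e : α ≃ β) (σ : Perm α) (z : β → List Bool) : lamf ℓ (e.permCongr σ) z = lamf ℓ σ (z ∘ e) := by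
  by_cases h : ∃ L : List α, FullL L ∧ L.formPerm = σ
  · obtain ⟨L, hL, rfl⟩ := h
    rw [lamf_of ℓ hℓ _ _ L hL rfl, lamf_of ℓ hℓ _ _ (L.map e) (hL.map e), List.flatMap_map]
    · rfl
    · ext b
      obtain ⟨a, rfl⟩ := e.surjective b
      rw [formPerm_map_apply e e.injective]
      simp [Equiv.permCongr_apply]
  · rw [lamf_zero ℓ σ _ h, lamf_zero]
    rintro ⟨L, hL, hs⟩
    apply h
    refine ⟨L.map e.symm, hL.map e.symm, ?_⟩
    ext a
    obtain ⟨b, rfl⟩ := e.symm.surjective a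
    rw [formPerm_map_apply e.symm e.symm.injective, hs]
    simp [Equiv.permCongr_apply]

theorem FullL.rot {α : Type*} [DecidableEq α] {L : List α} (h : FullL L) (q : α) :
    ∃ L', FullL (q :: L') ∧ (q :: L').formPerm = L.formPerm := by
  obtain ⟨s, t, rfl⟩ := List.append_of_mem (h.2.2 q)
  have hr : (s ++ q :: t) ~r (q :: (t ++ s)) := by simpa using List.isRotated_append (l := s) (l' := q :: t)
  refine ⟨t ++ s, ⟨by simp, hr.nodup_iff.1 h.2.1, fun a => hr.mem_iff.1 (h.2.2 a)⟩, (List.formPerm_eq_of_isRotated h.2.1 hr).symm⟩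

theorem formPerm_map_some {α : Type*} [DecidableEq α] (M : List α) :
    (M.map some).formPerm = optionCongr M.formPerm := by
  ext1 a
  cases a with
  | none => rw [List.formPerm_apply_of_notMem (by simp)]; simp
  | some a => rw [formPerm_map_apply some (Option.some_injective _)]; simp

theorem updz_tail {α : Type*} [DecidableEq α] (z : Option α → List Bool) (q : α) (M : List α) (h : q ∉ M) :
    M.flatMap (updz z q) = (M.map some).flatMap z := by
  rw [List.flatMap_map]
  refine List.flatMap_congr fun a ha => ?_
  have : a ≠ q := fun h' => h (h' ▸ ha)
  simp [updz, this]

theorem lamf_some (ℓ : List Bool → K) (hℓ : ∀ u v, ℓ (u ++ v) = ℓ (v ++ u)) {α : Type*} [DecidableEq α]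
    (z : Option α → List Bool) (e : Perm α) (q : α) :
    lamf ℓ (swap none (some q) * optionCongr e) z = lamf ℓ e (updz z q) := by
  by_cases h : ∃ L : List α, FullL L ∧ L.formPerm = e
  · obtain ⟨L, hL, rfl⟩ := h
    obtain ⟨M, hM, hML⟩ := hL.rot q
    rw [← hML, lamf_of ℓ hℓ _ _ (q :: M) hM rfl, lamf_of ℓ hℓ _ _ (none :: (q :: M).map some)]
    · have hq : q ∉ M := (List.nodup_cons.1 hM.2.1).1
      rw [List.flatMap_cons, List.flatMap_cons, updz_tail z q M hq, List.map_cons, List.flatMap_cons]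
      simp [updz]
    · refine ⟨by simp, List.nodup_cons.2 ⟨by simp, hM.2.1.map (Option.some_injective _)⟩, ?_⟩
      rintro (_ | a)
      · simp
      · have := hM.2.2 a
        exact List.mem_cons_of_mem _ (List.mem_map_of_mem this)
    · rw [← formPerm_map_some, List.map_cons, List.formPerm_cons_cons]
  · rw [lamf_zero ℓ e _ h, lamf_zero]
    rintro ⟨L, hL, hs⟩
    apply h
    obtain ⟨L', hL', hLL⟩ := hL.rot none
    rw [← hLL] at hs
    cases L' with
    | nil => have := hL'.2.2 (some q); simp at this
    | cons p L'' =>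
      have h1 : p = some q := by
        have := congrArg (fun g : Perm (Option α) => g none) hs
        simp only [List.formPerm_apply_head _ _ _ hL'.2.1] at this
        simpa using this
      subst h1
      have hn : none ∉ some q :: L'' := (List.nodup_cons.1 hL'.2.1).1
      obtain ⟨M, hM⟩ : ∃ M : List α, some q :: L'' = M.map some := by
        refine ⟨(some q :: L'').reduceOption, ?_⟩
        clear hs hL' hLL
        generalize some q :: L'' = l at hn
        induction l with
        | nil => rfl
        | cons a l ih =>
          cases a with
          | none => simp at hn
          | some a =>
            rw [List.reduceOption_cons_of_some, List.map_cons, ← ih]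
            exact fun h => hn (List.mem_cons_of_mem _ h)
      rw [List.formPerm_cons_cons, mul_right_inj, hM, formPerm_map_some] at hs
      refine ⟨M, ⟨?_, ?_, ?_⟩, optionCongr_injective hs⟩
      · rintro rfl; simp at hM
      · have := (List.nodup_cons.1 hL'.2.1).2
        rw [hM] at this
        exact List.Nodup.of_map _ this
      · intro a
        have := hL'.2.2 (some a)
        rw [hM] at this
        simpa using this

def lamPeel (ℓ : List Bool → K) (hℓ : ∀ u v, ℓ (u ++ v) = ℓ (v ++ u)) : Peel K where
  lam _ _ _ σ z := lamf ℓ σ z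
  ok α _ _ z := ∀ a, z a ≠ []
  ok_upd α _ _ z q h a := by
    by_cases hk : a = q
    · subst hk; simp [updz, h]
    · simp [updz, hk, h]
  lam_none α _ _ _ z e _ := lamf_fix ℓ _ none (by simp) z
  lam_some α _ _ z e q _ := lamf_some ℓ hℓ z e q

theorem lamf_unit (ℓ : List Bool → K) (hℓ : ∀ u v, ℓ (u ++ v) = ℓ (v ++ u)) (z : Unit → List Bool) :
    lamf ℓ 1 z = ℓ (z ()) := by
  rw [lamf_of ℓ hℓ _ _ [()] ⟨by simp, by simp, by simp⟩ (by simp)]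
  simp

def KillQ (ℓ : List Bool → K) : Prop := ∀ a b c d e : List Bool, a ≠ [] → b ≠ [] → c ≠ [] → d ≠ [] → e ≠ [] →
        q4 (fun w => ℓ (w ++ e)) [] a b c d = 0

theorem lamf_five (ℓ : List Bool → K) (hℓ : ∀ u v, ℓ (u ++ v) = ℓ (v ++ u)) (hk : KillQ ℓ) (z : Five → List Bool)
    (hz : ∀ a, z a ≠ []) : ∑ τ : Perm Five, ((Perm.sign τ : ℤˣ) : ℤ) • lamf ℓ τ z = 0 := by
  have h := (lamPeel ℓ hℓ).S_five ℓ (fun z _ => lamf_unit ℓ hℓ z) (z none) (z (some none)) (z (some (some none)))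
    (z (some (some (some none)))) (z (some (some (some (some ())))))
  have hz' : five (z none) (z (some none)) (z (some (some none)))
    (z (some (some (some none)))) (z (some (some (some (some ()))))) = z := by
    funext a
    rcases a with (_ | _ | _ | _ | _) <;> rfl
  rw [hz'] at h
  have h2 := h hz
  rw [hk _ _ _ _ _ (hz _) (hz _) (hz _) (hz _) (hz _)] at h2
  exact h2

theorem lamf_asym (ℓ : List Bool → K) (hℓ : ∀ u v, ℓ (u ++ v) = ℓ (v ++ u)) (hk : KillQ ℓ) (n : ℕ) :
    ∀ (α : Type) [Fintype α] [DecidableEq α] (_ : Fintype.card α = 5 + n) (f : Five → α) (_ : Function.Injective f)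
    (j : Perm Five → Perm α) (_ : ∀ τ k, j τ (f k) = f (τ k)) (_ : ∀ τ x, x ∉ Set.range f → j τ x = x)
    (σ : Perm α) (z : α → List Bool) (_ : ∀ a, z a ≠ []),
    ∑ τ : Perm Five, ((Perm.sign τ : ℤˣ) : ℤ) • lamf ℓ (σ * j τ) z = 0 := by
  induction n with
  | zero =>
    intro α _ _ hα f hf j hj _ σ z hz
    have hb : Function.Bijective f := (Fintype.bijective_iff_injective_and_card f).2 ⟨hf, by rw [hα]; rfl⟩
    let E := Equiv.ofBijective f hb
    have h1 : ∀ τ, lamf ℓ (σ * j τ) z = lamf ℓ (E.symm.permCongr σ * τ) (z ∘ f) := by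
      intro τ
      rw [show z ∘ f = z ∘ E from rfl, ← lamf_conj ℓ hℓ E]
      congr 1
      ext x
      obtain ⟨k, rfl⟩ := hb.2 x
      rw [Perm.mul_apply, hj]
      have : E.symm (f k) = k := E.symm_apply_apply k
      rw [Equiv.permCongr_apply, this]
      simp [Equiv.permCongr_apply]
      rfl
    simp only [h1]
    have h2 := lamf_five ℓ hℓ hk (z ∘ f) (fun a => hz _)
    rw [← Equiv.sum_comp (Equiv.mulLeft (E.symm.permCongr σ))] at h2
    simp only [Equiv.coe_mulLeft, Perm.sign_mul, Units.val_mul, mul_smul] at h2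
    rw [← Finset.smul_sum] at h2
    have h3 := congrArg (fun x => ((Perm.sign (E.symm.permCongr σ) : ℤˣ) : ℤ) • x) h2
    simp only [smul_zero, ← mul_smul] at h3
    rw [← Units.val_mul, Int.units_mul_self, Units.val_one, one_smul] at h3
    exact h3
  | succ n ih =>
    intro α _ _ hα f hf j hj hj' σ z hz
    obtain ⟨a, ha⟩ : ∃ a, a ∉ Set.range f := by
      by_contra h
      push Not at h
      have := Fintype.card_le_of_surjective f h
      rw [hα, show Fintype.card Five = 5 from rfl] at this
      omega
    let E := Equiv.optionSubtypeNe a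
    have hfa : ∀ k, f k ≠ a := fun k h => ha ⟨k, h⟩
    obtain ⟨p, e, hpe⟩ := perm_option_cases (E.symm.permCongr σ)
    -- restricted permutations
    have hja : ∀ τ, j τ a = a := fun τ => hj' τ a ha
    have hsub : ∀ τ x, x ≠ a ↔ j τ x ≠ a := by
      intro τ x
      refine not_congr ⟨fun h => by rw [h, hja], fun h => (j τ).injective (h.trans (hja τ).symm)⟩
    let j' : Perm Five → Perm {x // x ≠ a} := fun τ => (j τ).subtypePerm (fun x => (hsub τ x).symm)
    have h1 : ∀ τ, lamf ℓ (σ * j τ) z = lamf ℓ (swap none p * optionCongr (e * j' τ)) (z ∘ E) := by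
      intro τ
      rw [← lamf_conj ℓ hℓ E]
      congr 1
      have h2 : optionCongr (e * j' τ) = optionCongr e * optionCongr (j' τ) := by
        ext1 x; cases x <;> simp
      rw [h2, ← mul_assoc, ← hpe]
      ext x
      obtain ⟨y, rfl⟩ := E.surjective x
      rw [Perm.mul_apply, Equiv.permCongr_apply, E.symm_apply_apply, Perm.mul_apply, Equiv.permCongr_apply]
      simp only [E.symm_symm, E.apply_symm_apply]
      congr 1
      cases y with
      | none => simp [E, hja]
      | some y => simp [E, j']
    simp only [h1]
    cases p with
    | none =>
      have : Nontrivial (Option {x // x ≠ a}) := ⟨none, some ⟨_, hfa none⟩, by simp⟩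
      refine Finset.sum_eq_zero fun τ _ => ?_
      rw [lamf_fix ℓ _ none (by simp), smul_zero]
    | some q =>
      simp only [lamf_some ℓ hℓ]
      refine ih {x // x ≠ a} ?_ (fun k => ⟨f k, hfa k⟩) ?_ j' ?_ ?_ e _ ?_
      · have := Fintype.card_congr E
        rw [Fintype.card_option] at this
        omega
      · intro x y h
        exact hf (congrArg Subtype.val h)
      · intro τ k
        exact Subtype.ext (hj τ k)
      · intro τ x hx
        refine Subtype.ext (hj' τ x ?_)
        rintro ⟨k, hk⟩
        exact hx ⟨k, Subtype.ext hk⟩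
      · exact (lamPeel ℓ hℓ).ok_upd _ (z ∘ E) q (fun x => hz _)

end LamF
end
end

section
noncomputable section
section Functional
open Equiv
variable {K : Type*} [Field K]

theorem lamf_kill (ℓ : List Bool → K) (hℓ : ∀ u v, ℓ (u ++ v) = ℓ (v ++ u)) (hk : KillQ ℓ) {m : ℕ}
    (z : Fin m → List Bool) (hz : ∀ a, z a ≠ []) (σ : Perm (Fin m)) (f : Fin 5 ↪ Fin m) :
    ∑ τ : Perm (Fin 5), (((Perm.sign τ : ℤˣ) : ℤ) : K) * lamf ℓ (σ * τ.viaFintypeEmbedding f) z = 0 := by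
  have hm : 5 ≤ m := by simpa using Fintype.card_le_of_embedding f
  let E : Five ≃ Fin 5 := Fintype.equivFinOfCardEq rfl
  rw [← Equiv.sum_comp E.permCongr]
  rw [← lamf_asym ℓ hℓ hk (m - 5) (Fin m) (by simp; omega) (f ∘ E) (f.injective.comp E.injective)
    (fun τ => (E.permCongr τ).viaFintypeEmbedding f) ?_ ?_ σ z hz]
  · refine Finset.sum_congr rfl fun τ _ => ?_
    rw [Perm.sign_permCongr, zsmul_eq_mul]
  · intro τ k
    simp [Perm.viaFintypeEmbedding_apply_image, Equiv.permCongr_apply]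
  · intro τ x hx
    refine Perm.viaFintypeEmbedding_apply_notMem_range _ _ ?_
    rintro ⟨k, rfl⟩
    exact hx ⟨E.symm k, by simp⟩

/-- single letter generalized traces -/
def pl (K : Type*) [Field K] {m : ℕ} (σ : Perm (Fin m)) (b : Fin m → Bool) : MvPolynomial (MatVar 4) K :=
  ptr σ fun k => mat K [b k]

theorem pl_eq {m : ℕ} (σ : Perm (Fin m)) (b : Fin m → Bool) :
    pl K σ b = ∑ I : Fin m → Fin 4, ∏ k, X (vrEquiv m (b, I, I ∘ σ) k) := by
  rw [pl, ptr_eq]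
  refine Finset.sum_congr rfl fun I _ => Finset.prod_congr rfl fun k _ => ?_
  rw [mat_single]; rfl

theorem pl_homog {m : ℕ} (σ : Perm (Fin m)) (b : Fin m → Bool) : (pl K σ b).IsHomogeneous m := by
  rw [pl_eq]
  refine IsHomogeneous.sum _ _ _ fun I _ => ?_
  have := IsHomogeneous.prod (R := K) (Finset.univ : Finset (Fin m)) (fun k => X (vrEquiv m (b, I, I ∘ σ) k)) (fun _ => 1)
    (fun k _ => isHomogeneous_X _ _)
  simpa using this

theorem relation_pair [CharZero K] (ℓ : List Bool → K) (hℓ : ∀ u v, ℓ (u ++ v) = ℓ (v ++ u)) (hk : KillQ ℓ) {m : ℕ}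
    (c : Perm (Fin m) → (Fin m → Bool) → K) (h : ∑ σ, ∑ b, c σ b • pl K σ b = 0) :
    ∑ σ, ∑ b, c σ b * lamf ℓ σ (fun k => [b k]) = 0 := by
  classical
  -- conjugation
  let cj : Perm (Fin m) → Perm (Fin m) ≃ Perm (Fin m) := fun π => π.permCongr
  let bj : Perm (Fin m) → (Fin m → Bool) ≃ (Fin m → Bool) := fun π => π.arrowCongr (Equiv.refl _)
  have hlam : ∀ π τ b, lamf ℓ (cj π τ) (fun k => [bj π b k]) = lamf ℓ τ (fun k => [b k]) := by
    intro π τ b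
    rw [lamf_conj ℓ hℓ π]
    congr 1
    funext k
    simp [bj, Equiv.arrowCongr]
  let d : (Fin m → Bool) → Perm (Fin m) → K := fun b τ => ∑ π, c (cj π τ) (bj π b)
  have hd : ∀ (b0 : Fin m → Bool) (I0 J0 : Fin m → Fin 4), ∑ τ : Perm (Fin m), (if I0 ∘ τ = J0 then d b0 τ else 0) = 0 := by
    intro b0 I0 J0
    let t0 := vrEquiv m (b0, I0, J0)
    obtain ⟨Φ, hΦ⟩ := exists_phi (K := K) (m := m) (fun t : Fin m → MatVar 4 => ∑ π : Perm (Fin m), if t ∘ π = t0 then (1 : K) else 0) (by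
      intro t ρ
      refine Fintype.sum_equiv (Equiv.mulLeft ρ) _ _ fun π => ?_
      rfl)
    have h1 := congrArg Φ h
    simp only [map_sum, map_smul, map_zero, pl_eq, hΦ, smul_eq_mul] at h1
    have h2 : ∀ (π σ : Perm (Fin m)) (b : Fin m → Bool) (I : Fin m → Fin 4),
        vrEquiv m (b, I, I ∘ σ) ∘ π = vrEquiv m (b ∘ π, I ∘ π, I ∘ σ ∘ π) := fun π σ b I => rfl
    simp only [h2, t0, (vrEquiv m).injective.eq_iff, Prod.mk.injEq] at h1
    refine Eq.trans ?_ h1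
    have h3 : ∀ σ : Perm (Fin m), ∑ b : Fin m → Bool, c σ b * ∑ I : Fin m → Fin 4, ∑ π : Perm (Fin m),
        (if b ∘ π = b0 ∧ I ∘ π = I0 ∧ I ∘ σ ∘ π = J0 then (1 : K) else 0) =
        ∑ π : Perm (Fin m), if I0 ∘ ((cj π).symm σ) = J0 then c σ (bj π b0) else 0 := by
      intro σ
      simp only [Finset.mul_sum]
      calc _ = ∑ π : Perm (Fin m), ∑ b : Fin m → Bool, ∑ I : Fin m → Fin 4,
          c σ b * (if b ∘ π = b0 ∧ I ∘ π = I0 ∧ I ∘ σ ∘ π = J0 then (1 : K) else 0) := by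
            rw [Finset.sum_comm]
            rw [← Finset.sum_congr rfl fun b _ => Finset.sum_comm]
            rw [Finset.sum_comm]
            refine Finset.sum_congr rfl fun π _ => ?_
            rw [Finset.sum_comm]
        _ = _ := by
            refine Finset.sum_congr rfl fun π _ => ?_
            rw [Finset.sum_eq_single (bj π b0), Finset.sum_eq_single (I0 ∘ π.symm)]
            · have e1 : bj π b0 ∘ π = b0 := by funext k; simp [bj, Equiv.arrowCongr]
              have e2 : (I0 ∘ π.symm) ∘ π = I0 := by funext k; simp
              have e3 : (I0 ∘ π.symm) ∘ σ ∘ π = I0 ∘ ((cj π).symm σ) := by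
                funext k; simp [cj, Equiv.permCongr]
              simp [e1, e2, e3]
            · intro I _ hI
              rw [if_neg, mul_zero]
              rintro ⟨-, rfl, -⟩
              apply hI
              funext k; simp
            · simp
            · intro b _ hb
              refine Finset.sum_eq_zero fun I _ => ?_
              rw [if_neg, mul_zero]
              rintro ⟨rfl, -⟩
              apply hb
              funext k; simp [bj, Equiv.arrowCongr]
            · simp
    simp only [h3]
    rw [Finset.sum_comm]
    simp only [d]
    have h4 : ∀ τ : Perm (Fin m), (if I0 ∘ τ = J0 then ∑ π, c (cj π τ) (bj π b0) else 0) =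
        ∑ π, if I0 ∘ τ = J0 then c (cj π τ) (bj π b0) else 0 := by
      intro τ; split <;> simp
    simp only [h4]
    rw [Finset.sum_comm]
    refine Finset.sum_congr rfl fun π _ => ?_
    rw [← Equiv.sum_comp (cj π) (fun σ => if I0 ∘ ((cj π).symm σ) = J0 then c σ (bj π b0) else 0)]
    simp
  have h5 : ∀ b, ∑ τ, d b τ * lamf ℓ τ (fun k => [b k]) = 0 := fun b =>
    sft (d b) _ (hd b) fun σ f => lamf_kill ℓ hℓ hk _ (fun a => by simp) σ f
  have h6 : ∑ b, ∑ τ, d b τ * lamf ℓ τ (fun k => [b k]) =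
      ∑ π : Perm (Fin m), ∑ σ, ∑ b, c σ b * lamf ℓ σ (fun k => [b k]) := by
    simp only [d, Finset.sum_mul]
    rw [Finset.sum_congr rfl fun b _ => Finset.sum_comm, Finset.sum_comm]
    refine Finset.sum_congr rfl fun π _ => ?_
    rw [Finset.sum_comm]
    rw [← Equiv.sum_comp (cj π) (fun σ => ∑ b, c σ b * lamf ℓ σ (fun k => [b k]))]
    refine Finset.sum_congr rfl fun τ _ => ?_
    rw [← Equiv.sum_comp (bj π) (fun b => c (cj π τ) b * lamf ℓ (cj π τ) (fun k => [b k]))]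
    refine Finset.sum_congr rfl fun b _ => ?_
    rw [hlam]
  rw [Finset.sum_eq_zero fun b _ => h5 b, Finset.sum_const, nsmul_eq_mul] at h6
  rcases mul_eq_zero.1 h6.symm with h7 | h7
  · simp [Fintype.card_perm, Nat.factorial_ne_zero] at h7
  · exact h7

theorem exists_Lam0 [CharZero K] (ℓ : List Bool → K) (hℓ : ∀ u v, ℓ (u ++ v) = ℓ (v ++ u)) (hk : KillQ ℓ) (m : ℕ) :
    ∃ Λ : MvPolynomial (MatVar 4) K →ₗ[K] K, ∀ (σ : Perm (Fin m)) b, Λ (pl K σ b) = lamf ℓ σ (fun k => [b k]) := by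
  let f := Fintype.linearCombination K (fun p : Perm (Fin m) × (Fin m → Bool) => pl K p.1 p.2)
  let φ := Fintype.linearCombination K (fun p : Perm (Fin m) × (Fin m → Bool) => lamf ℓ p.1 (fun k => [p.2 k]))
  have h : φ ∈ (LinearMap.ker f).dualAnnihilator := by
    rw [Submodule.mem_dualAnnihilator]
    intro c hc
    rw [LinearMap.mem_ker, Fintype.linearCombination_apply, Fintype.sum_prod_type] at hc
    rw [Fintype.linearCombination_apply, Fintype.sum_prod_type]
    exact relation_pair ℓ hℓ hk (fun σ b => c (σ, b)) hc
  rw [← LinearMap.range_dualMap_eq_dualAnnihilator_ker] at h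
  obtain ⟨Λ, hΛ⟩ := h
  refine ⟨Λ, fun σ b => ?_⟩
  have := congrArg (fun g : _ →ₗ[K] K => g (Pi.single (σ, b) 1)) hΛ
  simpa [f, φ, Fintype.linearCombination_apply_single] using this

theorem expand (ℓ : List Bool → K) (hℓ : ∀ u v, ℓ (u ++ v) = ℓ (v ++ u)) (N : ℕ) (n : ℕ) : ∀ (α : Type) [Fintype α]
    [DecidableEq α] (σ : Perm α) (z : α → List Bool) (_ : ∀ a, z a ≠ []) (_ : ∑ a, (z a).length = N)
    (_ : Fintype.card α + n = N), ∃ (σ' : Perm (Fin N)) (b : Fin N → Bool),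
      ptr σ (fun k => mat K (z k)) = pl K σ' b ∧ lamf ℓ σ z = lamf ℓ σ' (fun k => [b k]) := by
  induction n with
  | zero =>
    intro α _ _ σ z hz hs hc
    have h1 : ∀ a, (z a).length = 1 := by
      have hle : ∀ a ∈ Finset.univ, 1 ≤ (z a).length := fun a _ => List.length_pos_iff.2 (hz a)
      have := (Finset.sum_eq_sum_iff_of_le hle).1 (by simp [hs, ← hc])
      exact fun a => (this a (Finset.mem_univ a)).symm
    choose b hb using fun a => List.length_eq_one_iff.1 (h1 a)
    let E : α ≃ Fin N := Fintype.equivFinOfCardEq (by omega)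
    refine ⟨E.permCongr σ, b ∘ E.symm, ?_, ?_⟩
    · rw [pl, ptr_conj]
      congr 1
      funext k
      simp [hb]
    · rw [lamf_conj ℓ hℓ]
      congr 1
      funext k
      simp [hb]
  | succ n ih =>
    intro α _ _ σ z hz hs hc
    obtain ⟨q, hq⟩ : ∃ q, (z q).length ≠ 1 := by
      by_contra h
      push Not at h
      simp [h] at hs
      omega
    obtain ⟨x, w, hxw⟩ := List.exists_cons_of_ne_nil (hz q)
    have hw : w ≠ [] := by rintro rfl; simp [hxw] at hq
    let z' : Option α → List Bool := fun o => o.elim [x] (Function.update z q w)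
    have hz' : updz z' q = z := by
      funext a
      by_cases ha : a = q
      · subst ha; simp [updz, z', hxw]
      · simp [updz, z', ha]
    obtain ⟨σ', b, h1, h2⟩ := ih (Option α) (swap none (some q) * optionCongr σ) z' (by
        rintro (_ | a)
        · simp [z']
        · by_cases ha : a = q
          · subst ha; simpa [z'] using hw
          · simp [z', ha, hz]) (by rw [← sum_len_update z' q, ← hs]; rw [show Function.update (z' ∘ some) q (z' none ++ z' (some q)) = z from hz'])
        (by rw [Fintype.card_option]; omega)
    refine ⟨σ', b, ?_, ?_⟩
    · rw [← h1, ptr_some, mat_update, show Function.update (z' ∘ some) q (z' none ++ z' (some q)) = z from hz']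
    · rw [← h2, lamf_some ℓ hℓ, hz']

theorem exists_Lam [CharZero K] (ℓ : List Bool → K) (hℓ : ∀ u v, ℓ (u ++ v) = ℓ (v ++ u)) (hk : KillQ ℓ) (N : ℕ) :
    ∃ Λ : MvPolynomial (MatVar 4) K →ₗ[K] K, ∀ (α : Type) [Fintype α]
    [DecidableEq α] (σ : Perm α) (z : α → List Bool) (_ : ∀ a, z a ≠ []),
    Λ (ptr σ (fun k => mat K (z k))) = if ∑ a, (z a).length = N then lamf ℓ σ z else 0 := by
  obtain ⟨Λ, hΛ⟩ := exists_Lam0 ℓ hℓ hk N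
  refine ⟨Λ ∘ₗ homogeneousComponent N, fun α _ _ σ z hz => ?_⟩
  have hle : Fintype.card α ≤ ∑ a, (z a).length := by
    rw [Fintype.card_eq_sum_ones]
    exact Finset.sum_le_sum fun a _ => List.length_pos_iff.2 (hz a)
  obtain ⟨σ', b, h1, h2⟩ := expand (K := K) ℓ hℓ (∑ a, (z a).length) (∑ a, (z a).length - Fintype.card α) α σ z hz rfl (by omega)
  rw [h1, h2, LinearMap.comp_apply]
  split
  · rename_i h
    subst h
    rw [homogeneousComponent_of_mem (pl_homog σ' b), if_pos rfl, hΛ]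
  · rename_i h
    rw [homogeneousComponent_of_mem (pl_homog σ' b), if_neg (Ne.symm h), map_zero]

/-- separation of a word from an algebra generated by other words -/
theorem separate [CharZero K] (ℓ : List Bool → K) (hℓ : ∀ u v, ℓ (u ++ v) = ℓ (v ++ u)) (hk : KillQ ℓ)
    (w : List Bool) (hw : w ≠ []) (hlw : ℓ w ≠ 0) (W : Set (List Bool)) (hW : ∀ v ∈ W, v ≠ [] ∧ ℓ v = 0) :
    trw K w ∉ Algebra.adjoin K (trw K '' W) := by
  obtain ⟨Λ, hΛ⟩ := exists_Lam ℓ hℓ hk w.length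
  have hone : ∀ v : List Bool, v ≠ [] → Λ (trw K v) = if v.length = w.length then ℓ v else 0 := by
    intro v hv
    have := hΛ Unit 1 (fun _ => v) (fun _ => hv)
    rw [lamf_unit ℓ hℓ] at this
    simp only [Finset.univ_unique, Finset.sum_const, Finset.card_singleton, one_smul] at this
    rw [← this]
    congr 1
    rw [ptr_eq, ← (Equiv.funUnique Unit (Fin 4)).symm.sum_comp]
    simp [trw, Matrix.trace]
  intro hmem
  have h0 : Λ (trw K w) = 0 := by
    rw [← Subalgebra.mem_toSubmodule, Algebra.adjoin_eq_span] at hmem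
    refine (LinearMap.mem_ker).1 ((Submodule.span_le.2 ?_) hmem : _ ∈ LinearMap.ker Λ)
    intro g hg
    obtain ⟨l, hl, rfl⟩ := Submonoid.exists_list_of_mem_closure hg
    obtain ⟨l', hl', rfl⟩ : ∃ l' : List (List Bool), (∀ v ∈ l', v ∈ W) ∧ l'.map (trw K) = l := by
      clear hg
      induction l with
      | nil => exact ⟨[], by simp, rfl⟩
      | cons a l ih =>
        simp only [List.forall_mem_cons] at hl
        obtain ⟨l', h1, h2⟩ := ih hl.2
        obtain ⟨v, hv, rfl⟩ := hl.1
        exact ⟨v :: l', by simpa using ⟨hv, h1⟩, by simp [h2]⟩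
    simp only [SetLike.mem_coe, LinearMap.mem_ker]
    have hp : (l'.map (trw K)).prod = ptr (1 : Perm (Fin l'.length)) (fun k => mat K (l'.get k)) := by
      rw [ptr_eq]
      simp only [Perm.one_apply]
      have h := Finset.prod_univ_sum (fun _ : Fin l'.length => (Finset.univ : Finset (Fin 4))) (fun k i => mat K (l'.get k) i i)
      rw [Fintype.piFinset_univ] at h
      rw [← h, ← List.prod_ofFn]
      congr 1
      apply List.ext_get <;> simp [trw, Matrix.trace]
    rw [hp, hΛ _ _ _ (fun a => (hW _ (hl' _ (List.get_mem _ _))).1)]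
    split
    · match l', hl' with
      | [], _ =>
        refine lamf_zero _ _ _ ?_
        rintro ⟨L, hL, -⟩
        obtain ⟨a, -⟩ := List.exists_mem_of_ne_nil _ hL.1
        exact a.elim0
      | [v], hl' =>
        have hc := lamf_of ℓ hℓ (1 : Perm (Fin 1)) (fun k => [v].get k) [0] ⟨by simp, by simp, by simp [Fin.forall_fin_one]⟩ (by simp)
        refine hc.trans ?_
        simpa using (hW v (hl' v (by simp))).2
      | v :: u :: l', _ =>
        have : Nontrivial (Fin (v :: u :: l').length) := Fin.nontrivial_iff_two_le.2 (by simp)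
        exact lamf_fix ℓ 1 ⟨0, by simp⟩ rfl _
    · rfl
  rw [hone w hw, if_pos rfl] at h0
  exact hlw h0

end Functional
end
end

section
def tabs : List (ℕ × ℕ) :=
  [(1, 45),
  (2, 2925),
  (3, 11983725),
  (4, 201052481018733),
  (5, 45292318721359127235771353892),
  (6, 3586890969120343709544070667663710196295401573989710154020),
  (7, 22515432112789832367834763684400372871556072112764192405787526153324739488885689226350146214319076734388935903562020),
  (8, 887153195600405107146335182725456557811166713545328429249572746311469075531070913566747907478794280991973878124547141181031393653483147208186868694807445720402678480844587496542938873735311925267966013731456039384194054622417144100),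
  (9, 1377321386812018622045780917730465093167224952969668596959476526268709298575593063972236311794153664502687698894219554298649545686187201378971838234384808371691968400946062787995264671699811484272612001790486096271709391416483689102217049879894868182905224802498880869877825947739713379592891440052841900665724034929493535223916587660329140974722999277137437722227534892730864072669654104532161780639338228420639080068412110869905892735799425756876621755763018020),
  (10, 3319774854497118893062572876174042497535414386493082992377992087021259274855491361624788074561006195140197947581201187570404960204589925218013594572660325987556717675433723801950594139224301128615778407056834368662665367374963486042185611861239616999203496457224060446515853644839534849192685778453280373499861418086163236179918792308048980603924262078674037998112663996962018245115569547257201205990875594357909796674940135585324194402424870078312165037236213247595730952923330202527189789879763942004860900745599898967548010502233516685990051608834935018084564513030539538913088082594170748539230947530947497120080235643978845104785055759805244445028229454571658830027889011211077990401565927660155338741733141794206787133617260906485157432141699536822172569386560485862127873266193215848899256443963849787827764455395539283723484588254621131825372656135726045621785815239711279033633347808374838745578162963849442564917540),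
  (4, 160843917609252),
  (6, 3586914903222074522681242545906537820787865771374646806820),
  (8, 887153195600405105799416771540811424697192844116865898664348533461815833420135453195450979086712097930810197705054645547017672190282291994592668660954040773520550886954339269332340078691897972198059793757622123395405571624753318180)]

def valw (w : List Bool) : ℕ := w.foldl (fun a b => 2 * a + b.toNat) 0

theorem foldl_valw (v : List Bool) (x : ℕ) : v.foldl (fun a b => 2 * a + b.toNat) x = x * 2 ^ v.length + valw v := by
  induction v generalizing x with
  | nil => simp [valw]
  | cons b v ih =>
    simp only [valw, List.foldl_cons, List.length_cons]
    rw [ih, ih (2 * 0 + b.toNat)]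
    ring

theorem valw_append (u v : List Bool) : valw (u ++ v) = valw u * 2 ^ v.length + valw v := by
  rw [valw, List.foldl_append, foldl_valw]; rfl

theorem valw_lt (u : List Bool) : valw u < 2 ^ u.length := by
  induction u using List.reverseRecOn with
  | nil => simp [valw]
  | append_singleton u b ih =>
    rw [valw_append]
    have : valw [b] ≤ 1 := by cases b <;> simp [valw]
    simp only [List.length_append, List.length_singleton, pow_succ, pow_zero]
    omega

def lane (T v : ℕ) : ℕ := Nat.shiftRight T (3 * v) % 8

def allLt : ℕ → (ℕ → Bool) → Bool
  | 0, _ => true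
  | n + 1, p => p n && allLt n p

theorem allLt_spec {n : ℕ} {p : ℕ → Bool} (h : allLt n p = true) (i : ℕ) (hi : i < n) : p i = true := by
  induction n with
  | zero => omega
  | succ n ih =>
    simp only [allLt, Bool.and_eq_true] at h
    rcases Nat.lt_succ_iff_lt_or_eq.1 hi with h1 | rfl
    · exact ih h.2 h1
    · exact h.1

def n2 (L : ℕ → ℕ) (v a pa b pb : ℕ) : ℕ := L ((v * pa + a) * pb + b) + L ((v * pb + b) * pa + a)
def n3 (L : ℕ → ℕ) (v a pa b pb c pc : ℕ) : ℕ :=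
  n2 L (v * pa + a) b pb c pc + n2 L (v * pb + b) a pa c pc + n2 L (v * pc + c) a pa b pb
def n4 (L : ℕ → ℕ) (a pa b pb c pc d pd : ℕ) : ℕ :=
  n3 L a b pb c pc d pd + n3 L b a pa c pc d pd + n3 L c a pa b pb d pd + n3 L d a pa b pb c pc

def imp (a : Bool) (b : Bool) : Bool := !a || b

def chkCyc (n T : ℕ) : Bool :=
  allLt (2 ^ (n - 1)) fun v => allLt 2 fun b => Nat.beq (lane T (b * 2 ^ (n - 1) + v)) (lane T (v * 2 + b))

def chkKill (n T : ℕ) : Bool :=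
  allLt (n - 4) fun la => allLt (n - 4) fun lb => imp (Nat.ble la lb) <| allLt (n - 4) fun lc => imp (Nat.ble lb lc) <|
  allLt (n - 4) fun ld => imp (Nat.ble lc ld && Nat.ble (la + lb + lc + ld + 5) n) <|
  allLt (2 ^ (la + 1)) fun a => allLt (2 ^ (lb + 1)) fun b => imp (Nat.ble (2 ^ (la + 1) + a) (2 ^ (lb + 1) + b)) <|
  allLt (2 ^ (lc + 1)) fun c => imp (Nat.ble (2 ^ (lb + 1) + b) (2 ^ (lc + 1) + c)) <|
  allLt (2 ^ (ld + 1)) fun d => imp (Nat.ble (2 ^ (lc + 1) + c) (2 ^ (ld + 1) + d)) <|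
  allLt (2 ^ (n - (la + lb + lc + ld + 4))) fun e =>
    Nat.beq (n4 (fun v => lane T (v * 2 ^ (n - (la + lb + lc + ld + 4)) + e)) a (2 ^ (la + 1)) b (2 ^ (lb + 1)) c (2 ^ (lc + 1)) d (2 ^ (ld + 1))) 96

theorem tabs_cyc : ∀ p ∈ tabs, chkCyc p.1 p.2 = true := by decide +kernel
theorem tabs_kill : ∀ p ∈ tabs, chkKill p.1 p.2 = true := by decide +kernel
theorem tabs_gen : ∀ i : Fin 32, ∃ p ∈ tabs, p.1 = (wd (genCodes.get i)).length ∧ lane p.2 (valw (wd (genCodes.get i))) ≠ 4 ∧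
    ∀ j : Fin 32, j ≠ i → (wd (genCodes.get j)).length = p.1 →
      (wd (genCodes.get j)).count true = (wd (genCodes.get i)).count true → lane p.2 (valw (wd (genCodes.get j))) = 4 := by
  decide +kernel
end

section
noncomputable section
section Minimal

def ellw (K : Type*) [Field K] (n k T : ℕ) (w : List Bool) : K :=
  if w.length = n ∧ w.count true = k then (lane T (valw w) : K) - 4 else 0

theorem ellw_rot (K : Type*) [Field K] (n k T : ℕ) (h : chkCyc n T = true) (b : Bool) (v : List Bool) :
    ellw K n k T (b :: v) = ellw K n k T (v ++ [b]) := by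
  unfold ellw
  have e1 : (b :: v).length = (v ++ [b]).length := by simp
  have e2 : (b :: v).count true = (v ++ [b]).count true := by
    rw [List.count_append, List.count_cons]; cases b <;> simp
  rw [e1, e2]
  by_cases hc : (v ++ [b]).length = n ∧ (v ++ [b]).count true = k
  · rw [if_pos hc, if_pos hc]
    have hn : n - 1 = v.length := by have := hc.1; simp at this; omega
    unfold chkCyc at h
    rw [hn] at h
    have h1 := Nat.eq_of_beq_eq_true (allLt_spec (allLt_spec h (valw v) (valw_lt v)) b.toNat (by cases b <;> simp))
    have h2 : valw (b :: v) = b.toNat * 2 ^ v.length + valw v := by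
      have := valw_append [b] v
      rw [List.singleton_append] at this
      rw [this]; congr 2; cases b <;> rfl
    have h3 : valw (v ++ [b]) = valw v * 2 + b.toNat := by
      rw [valw_append]; congr 1; cases b <;> rfl
    rw [h2, h3, h1]
  · rw [if_neg hc, if_neg hc]

theorem ellw_cyc (K : Type*) [Field K] (n k T : ℕ) (h : chkCyc n T = true) (u v : List Bool) :
    ellw K n k T (u ++ v) = ellw K n k T (v ++ u) := by
  induction u generalizing v with
  | nil => simp
  | cons b u ih =>
    rw [List.cons_append, ellw_rot K n k T h, List.append_assoc, ih, List.append_assoc, List.singleton_append]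

theorem imp_spec {a b : Bool} (h : imp a b = true) (ha : a = true) : b = true := by
  subst ha; simpa [imp] using h

theorem q4_congr2 {M : Type*} [AddCommGroup M] (f g : List Bool → M) (n k : ℕ)
    (hf : ∀ w : List Bool, w.length = n → w.count true = k → f w = g w) (a b c d : List Bool)
    (h : a.length + b.length + c.length + d.length = n)
    (h2 : a.count true + b.count true + c.count true + d.count true = k) : q4 f [] a b c d = q4 g [] a b c d := by
  simp only [q4, q3, q2, List.nil_append]
  repeat rw [hf _ (by simp only [List.length_append]; omega) (by simp only [List.count_append]; omega)]

theorem q4_sab {M : Type*} [AddCommGroup M] (f : List Bool → M) (a b c d : List Bool) :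
    q4 f [] a b c d = q4 f [] b a c d := by
  simp only [q4, q3, q2, List.nil_append]; abel
theorem q4_sbc {M : Type*} [AddCommGroup M] (f : List Bool → M) (a b c d : List Bool) :
    q4 f [] a b c d = q4 f [] a c b d := by
  simp only [q4, q3, q2, List.nil_append]; abel
theorem q4_scd {M : Type*} [AddCommGroup M] (f : List Bool → M) (a b c d : List Bool) :
    q4 f [] a b c d = q4 f [] a b d c := by
  simp only [q4, q3, q2, List.nil_append]; abel

theorem q4_n4 (K : Type*) [Field K] (L : ℕ → ℕ) (a b c d : List Bool) :
    q4 (fun w => (L (valw w) : K) - 4) [] a b c d = (n4 L (valw a) (2 ^ a.length) (valw b) (2 ^ b.length)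
      (valw c) (2 ^ c.length) (valw d) (2 ^ d.length) : ℕ) - 96 := by
  simp only [q4, q3, q2, List.nil_append, valw_append, n4, n3, n2]
  push_cast
  ring

def kapw (w : List Bool) : ℕ := 2 ^ w.length + valw w

theorem kapw_len {u v : List Bool} (h : kapw u ≤ kapw v) : u.length ≤ v.length := by
  by_contra hc
  have h1 : 2 ^ (v.length + 1) ≤ 2 ^ u.length := Nat.pow_le_pow_right (by norm_num) (by omega)
  have h2 := valw_lt v
  unfold kapw at h
  rw [pow_succ] at h1
  omega

theorem kill_sorted (K : Type*) [Field K] (n k T : ℕ) (h : chkKill n T = true) (a b c d e : List Bool)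
    (ha : a ≠ []) (hb : b ≠ []) (hc : c ≠ []) (hd : d ≠ []) (he : e ≠ [])
    (hab : kapw a ≤ kapw b) (hbc : kapw b ≤ kapw c) (hcd : kapw c ≤ kapw d) :
    q4 (fun w => ellw K n k T (w ++ e)) [] a b c d = 0 := by
  by_cases hl : a.length + b.length + c.length + d.length + e.length = n
  · by_cases hk : a.count true + b.count true + c.count true + d.count true + e.count true = k
    · rw [q4_congr2 _ (fun w => ((fun v => lane T (v * 2 ^ e.length + valw e)) (valw w) : K) - 4)
        (a.length + b.length + c.length + d.length) (a.count true + b.count true + c.count true + d.count true) ?_ a b c d rfl rfl]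
      · refine (q4_n4 K (fun v => lane T (v * 2 ^ e.length + valw e)) a b c d).trans ?_
        have la : a.length - 1 + 1 = a.length := Nat.sub_add_cancel (List.length_pos_iff.2 ha)
        have lb : b.length - 1 + 1 = b.length := Nat.sub_add_cancel (List.length_pos_iff.2 hb)
        have lc : c.length - 1 + 1 = c.length := Nat.sub_add_cancel (List.length_pos_iff.2 hc)
        have ld : d.length - 1 + 1 = d.length := Nat.sub_add_cancel (List.length_pos_iff.2 hd)
        have le : 1 ≤ e.length := List.length_pos_iff.2 he
        have kab := kapw_len hab
        have kbc := kapw_len hbc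
        have kcd := kapw_len hcd
        unfold chkKill at h
        have h := allLt_spec h (a.length - 1) (by omega)
        have h := imp_spec (allLt_spec h (b.length - 1) (by omega)) (Nat.ble_eq_true_of_le (by omega))
        have h := imp_spec (allLt_spec h (c.length - 1) (by omega)) (Nat.ble_eq_true_of_le (by omega))
        have h := imp_spec (allLt_spec h (d.length - 1) (by omega)) (by
          rw [Nat.ble_eq_true_of_le (by omega), Nat.ble_eq_true_of_le (by omega)]; rfl)
        have el : n - (a.length - 1 + (b.length - 1) + (c.length - 1) + (d.length - 1) + 4) = e.length := by omega
        rw [la, lb, lc, ld, el] at h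
        have h := allLt_spec h (valw a) (valw_lt a)
        have h := imp_spec (allLt_spec h (valw b) (valw_lt b)) (Nat.ble_eq_true_of_le hab)
        have h := imp_spec (allLt_spec h (valw c) (valw_lt c)) (Nat.ble_eq_true_of_le hbc)
        have h := imp_spec (allLt_spec h (valw d) (valw_lt d)) (Nat.ble_eq_true_of_le hcd)
        have h := Nat.eq_of_beq_eq_true (allLt_spec h (valw e) (valw_lt e))
        rw [h]
        norm_num
      · intro w hw1 hw2
        simp only [ellw]
        rw [if_pos ⟨by simp only [List.length_append]; omega, by simp only [List.count_append]; omega⟩, valw_append]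
    · rw [q4_congr2 _ (fun _ => (0 : K))
        (a.length + b.length + c.length + d.length) (a.count true + b.count true + c.count true + d.count true) ?_ a b c d rfl rfl]
      · simp [q4, q3, q2]
      · intro w hw1 hw2
        simp only [ellw]
        rw [if_neg]
        simp only [List.count_append]
        rintro ⟨-, h2⟩
        omega
  · rw [q4_congr2 _ (fun _ => (0 : K))
      (a.length + b.length + c.length + d.length) (a.count true + b.count true + c.count true + d.count true) ?_ a b c d rfl rfl]
    · simp [q4, q3, q2]
    · intro w hw1 hw2
      simp only [ellw]
      rw [if_neg]
      simp only [List.length_append]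
      rintro ⟨h2, -⟩
      omega

theorem ellw_kill (K : Type*) [Field K] (n k T : ℕ) (h : chkKill n T = true) : KillQ (ellw K n k T) := by
  have H0 := kill_sorted K n k T h
  have H1 : ∀ a b c d e : List Bool, a ≠ [] → b ≠ [] → c ≠ [] → d ≠ [] → e ≠ [] → kapw a ≤ kapw b → kapw b ≤ kapw c →
      q4 (fun w => ellw K n k T (w ++ e)) [] a b c d = 0 := by
    intro a b c d e ha hb hc hd he h1 h2
    rcases le_total (kapw c) (kapw d) with h3 | h3
    · exact H0 a b c d e ha hb hc hd he h1 h2 h3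
    rw [q4_scd]
    rcases le_total (kapw b) (kapw d) with h4 | h4
    · exact H0 a b d c e ha hb hd hc he h1 h4 h3
    rw [q4_sbc]
    rcases le_total (kapw a) (kapw d) with h5 | h5
    · exact H0 a d b c e ha hd hb hc he h5 h4 h2
    rw [q4_sab]
    exact H0 d a b c e hd ha hb hc he h5 h1 h2
  have H2 : ∀ a b c d e : List Bool, a ≠ [] → b ≠ [] → c ≠ [] → d ≠ [] → e ≠ [] → kapw a ≤ kapw b →
      q4 (fun w => ellw K n k T (w ++ e)) [] a b c d = 0 := by
    intro a b c d e ha hb hc hd he h1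
    rcases le_total (kapw b) (kapw c) with h3 | h3
    · exact H1 a b c d e ha hb hc hd he h1 h3
    rw [q4_sbc]
    rcases le_total (kapw a) (kapw c) with h4 | h4
    · exact H1 a c b d e ha hc hb hd he h4 h3
    rw [q4_sab]
    exact H1 c a b d e hc ha hb hd he h4 h1
  intro a b c d e ha hb hc hd he
  rcases le_total (kapw a) (kapw b) with h3 | h3
  · exact H2 a b c d e ha hb hc hd he h3
  rw [q4_sab]
  exact H2 b a c d e hb ha hc hd he h3

theorem gen_separate (K : Type*) [Field K] [CharZero K] (i : Fin 32) :
    gens32' K i ∉ Algebra.adjoin K (trw K '' {v | ∃ j : Fin 32, j ≠ i ∧ v = wd (genCodes.get j)}) := by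
  obtain ⟨p, hp, h1, h2, h3⟩ := tabs_gen i
  rw [gen_wd]
  refine separate (ellw K p.1 ((wd (genCodes.get i)).count true) p.2) (ellw_cyc K _ _ _ (tabs_cyc p hp))
    (ellw_kill K _ _ _ (tabs_kill p hp)) _ (genCodes_ne _ (List.get_mem _ _)) ?_ _ ?_
  · unfold ellw
    rw [if_pos ⟨h1.symm, rfl⟩, sub_ne_zero]
    exact_mod_cast h2
  · rintro _ ⟨j, hj, rfl⟩
    refine ⟨genCodes_ne _ (List.get_mem _ _), ?_⟩
    unfold ellw
    split
    · rename_i h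
      rw [h3 j hj h.1 h.2]
      norm_num
    · rfl

theorem minimality (K : Type*) [Field K] [CharZero K] (T : Set (MvPolynomial (MatVar 4) K))
    (hT : T ⊂ Set.range (gens32' K)) : Algebra.adjoin K T ≠ pureAlg K 4 := by
  intro hA
  obtain ⟨_, ⟨i, rfl⟩, hi⟩ := Set.exists_of_ssubset hT
  apply gen_separate K i
  have h1 : gens32' K i ∈ Algebra.adjoin K T := by
    rw [hA, gen_wd]; exact trw_mem_pure K _
  refine Algebra.adjoin_mono ?_ h1
  intro t ht
  obtain ⟨j, rfl⟩ := hT.1 ht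
  refine ⟨_, ⟨j, ?_, rfl⟩, (gen_wd j K).symm⟩
  rintro rfl
  exact hi ht

end Minimal
end
end

/-- In the minimal generating set of `C_{4,2}` from Theorem `Gen-1`, the words
`y³x²yx, y³x²y²x, y²x²yxy²x, y³xy²xyx` can be replaced by `xyx²y³, xy²x²y³, xy²xyx²y²,
xyxy²xy³` respectively, and the resulting 32 traces still form a minimal generating set
of the `K`-algebra `C_{4,2}`. -/
theorem minimal_generators_C42' (K : Type*) [Field K] [CharZero K] :
    Algebra.adjoin K (Set.range (gens32' K)) = pureAlg K 4 ∧
    ∀ T : Set (MvPolynomial (MatVar 4) K), T ⊂ Set.range (gens32' K) →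
      Algebra.adjoin K T ≠ pureAlg K 4 :=
  ⟨generation K, minimality K⟩
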